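/- arXiv:1507.01406 — 3 statements merged into one kernel-verified Lean document; each statement's English description precedes it below -/
import Mathlib

section
/- Let G be a finite group, H a normal subgroup of G of odd order such that G/H is isomorphic to the alternating group A6, and E a normal subgroup of G which is perfect, whose center Z(E) has order 3, and such that E/Z(E) is isomorphic to A6 (i.e. E ≅ 3.A6, the triple cover of A6). Then: G = HE; every element of H commutes with every element of E (so G is a central product of H and E); H ∩ E = Z(E), which is cyclic of order 3; Z(G) ≤ H; and H = C_G(E), the centralizer of E in G. -/
open Subgroup

theorem Subgroup.Normal.le_or_sup_eq_top_of_isSimpleGroup_quotient {G : Type*} [Group G]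
    {H : Subgroup G} (hH : H.Normal) (N : Subgroup G) [N.Normal] [IsSimpleGroup (G ⧸ N)] :
    H ≤ N ∨ H ⊔ N = ⊤ := by
  have hmap : (H.map (QuotientGroup.mk' N)).Normal :=
    hH.map _ (QuotientGroup.mk'_surjective N)
  have hcomap := comap_map_eq (QuotientGroup.mk' N) H
  rw [QuotientGroup.ker_mk'] at hcomap
  rcases hmap.eq_bot_or_eq_top with h | h
  · left
    rwa [Subgroup.map_eq_bot_iff, QuotientGroup.ker_mk'] at h
  · right
    rw [← hcomap, h, comap_top]

/-- A consequence of the three subgroups lemma. -/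
theorem Subgroup.le_centralizer_of_commutator_commutator_eq_bot {G : Type*} [Group G]
    {H E : Subgroup G} (hE : ⁅E, E⁆ = E) (h : ⁅⁅H, E⁆, E⁆ = ⊥) :
    H ≤ centralizer (E : Set G) := by
  rw [le_centralizer_iff, ← commutator_eq_bot_iff_le_centralizer]
  nth_rewrite 1 [← hE]
  exact commutator_commutator_eq_bot_of_rotate (by rwa [commutator_comm E H]) h

theorem Subgroup.index_dvd_card_of_sup_eq_top {G : Type*} [Group G] {H N : Subgroup G}
    [N.Normal] (h : H ⊔ N = ⊤) : N.index ∣ Nat.card H := by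
  rw [← relIndex_top_right, ← h, relIndex_sup_right]
  exact relIndex_dvd_card N H


/-- if `H ⊴ G` has odd order with `G/H ≅ A₆` and `E ⊴ G` is perfect with center
of order `3` and `E/Z(E) ≅ A₆` (i.e. `E ≅ 3.A₆`), then `G = HE`, `[H, E] = 1` (so `G` is a
central product of `H` and `E`), `H ∩ E = Z(E)` is cyclic of order `3`, `Z(G) ≤ H`, and
`H = C_G(E)`. -/
theorem statement_9 (G : Type) [Group G] [Finite G]
    (H : Subgroup G) [H.Normal] (hHodd : Odd (Nat.card H))
    (hGH : Nonempty ((G ⧸ H) ≃* alternatingGroup (Fin 6)))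
    (E : Subgroup G) [E.Normal]
    (hEperf : commutator ↥E = ⊤)
    (hEZ : Nat.card (Subgroup.center ↥E) = 3)
    (hEq : Nonempty ((↥E ⧸ Subgroup.center ↥E) ≃* alternatingGroup (Fin 6))) :
    H ⊔ E = ⊤ ∧
    (∀ h ∈ H, ∀ e ∈ E, h * e = e * h) ∧
    H ⊓ E = (Subgroup.center ↥E).map E.subtype ∧
    Nat.card ↥(H ⊓ E) = 3 ∧ IsCyclic ↥(H ⊓ E) ∧
    Subgroup.center G ≤ H ∧
    H = Subgroup.centralizer (E : Set G) := by
  obtain ⟨eG⟩ := hGH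
  obtain ⟨eE⟩ := hEq
  have hA : Nat.card (alternatingGroup (Fin 6)) = 360 := by
    rw [nat_card_alternatingGroup, Nat.card_fin]; rfl
  have : IsSimpleGroup (alternatingGroup (Fin 6)) := alternatingGroup.isSimpleGroup (by simp)
  have : IsSimpleGroup (G ⧸ H) := eG.isSimpleGroup
  have : IsSimpleGroup (↥E ⧸ center ↥E) := eE.isSimpleGroup
  have hHindex : H.index = 360 := by rw [index_eq_card, Nat.card_congr eG.toEquiv, hA]
  have hZindex : (center ↥E).index = 360 := by
    rw [index_eq_card, Nat.card_congr eE.toEquiv, hA]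
  have hEcard : Nat.card E = 1080 := by rw [← card_mul_index (center ↥E), hEZ, hZindex]
  have not_dvd {n m : ℕ} (hn : Odd n) (hm : Even m) : ¬ m ∣ n := fun h =>
    Nat.not_even_iff_odd.mpr hn (hm.trans_dvd h)
  have hsup : E ⊔ H = ⊤ :=
    ((inferInstance : E.Normal).le_or_sup_eq_top_of_isSimpleGroup_quotient H).resolve_left
      fun h => not_dvd hHodd (by rw [hEcard]; decide) (card_dvd_of_le h)
  have hKcard : Nat.card (H.subgroupOf E) = 3 := by
    have hindex : (H.subgroupOf E).index = 360 := by
      change H.relIndex E = 360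
      rw [← relIndex_sup_right, hsup, relIndex_top_right, hHindex]
    have := card_mul_index (H.subgroupOf E)
    rw [hindex, hEcard] at this
    omega
  have hKZ : H.subgroupOf E = center ↥E := by
    refine eq_of_le_of_card_ge ?_ (by rw [hEZ, hKcard])
    refine ((inferInstance : (H.subgroupOf E).Normal).le_or_sup_eq_top_of_isSimpleGroup_quotient
      (center ↥E)).resolve_right fun h => ?_
    have := index_dvd_card_of_sup_eq_top h
    rw [hZindex, hKcard] at this
    omega
  have hinf : H ⊓ E = (center ↥E).map E.subtype := by rw [← hKZ, subgroupOf_map_subtype]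
  have hinfcard : Nat.card ↥(H ⊓ E) = 3 := by
    rw [hinf, card_map_of_injective E.subtype_injective, hEZ]
  have hEE : ⁅E, E⁆ = E := by
    rw [← map_subtype_commutator, hEperf, ← MonoidHom.range_eq_map, range_subtype]
  have hHC : H ≤ centralizer (E : Set G) := by
    refine le_centralizer_of_commutator_commutator_eq_bot hEE ?_
    rw [commutator_eq_bot_iff_le_centralizer]
    refine (commutator_le_inf H E).trans ?_
    rw [hinf]
    rintro _ ⟨z, hz, rfl⟩
    exact mem_centralizer_iff.mpr fun e he =>
      congrArg Subtype.val (mem_center_iff.mp hz ⟨e, he⟩)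
  have hCH : centralizer (E : Set G) ≤ H := by
    refine ((inferInstance : (centralizer (E : Set G)).Normal
      ).le_or_sup_eq_top_of_isSimpleGroup_quotient H).resolve_right fun h => ?_
    rw [sup_eq_left.mpr hHC] at h
    have hcenter : center ↥E = ⊤ := eq_top_iff.mpr fun z _ => mem_center_iff.mpr fun e => by
      have hz : (z : G) ∈ centralizer (E : Set G) := h ▸ mem_top _
      exact Subtype.ext (mem_centralizer_iff.mp hz e e.2)
    rw [hcenter, index_top] at hZindex
    omega
  refine ⟨by rw [sup_comm, hsup], fun h hh e he => (mem_centralizer_iff.mp (hHC hh) e he).symm,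
    hinf, hinfcard, ?_, (center_le_centralizer _).trans hCH, le_antisymm hHC hCH⟩
  have : Fact (Nat.Prime 3) := ⟨Nat.prime_three⟩
  exact isCyclic_of_prime_card hinfcard
end

section
/- Let k be an algebraically closed field of characteristic 2. Then the second cohomology groups H²(A6, kˣ) and H²(A7, kˣ) of the alternating groups A6 and A7, with coefficients in the multiplicative group kˣ regarded as a trivial module, each have order 3 (hence are cyclic of order 3). -/
/-- Inhomogeneous `2`-cocycles for the trivial action, in curried form. -/
def IsTrivialTwoCocycle {G A : Type*} [Mul G] [Add A] (f : G → G → A) : Prop :=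
  ∀ g h j, f (g * h) j + f g h = f h j + f g (h * j)

/-- Inhomogeneous `2`-coboundaries for the trivial action, in curried form. -/
def IsTrivialTwoCoboundary {G A : Type*} [Mul G] [AddGroup A] (f : G → G → A) : Prop :=
  ∃ x : G → A, ∀ g h, x h - x (g * h) + x g = f g h

namespace IsTrivialTwoCocycle

section Basic

variable {G A : Type*} [Group G] [AddCommGroup A] {f : G → G → A}

theorem map_one_left (hf : IsTrivialTwoCocycle f) (g : G) : f 1 g = f 1 1 := by
  have := hf 1 1 g
  simp only [one_mul] at this
  exact (add_left_cancel this).symm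

theorem comp_monoidHom {H : Type*} [Group H] (hf : IsTrivialTwoCocycle f) (φ : H →* G) :
    IsTrivialTwoCocycle fun p q => f (φ p) (φ q) := fun p q r => by
  simpa only [map_mul] using hf (φ p) (φ q) (φ r)

/-- The commutator pairing of a cocycle is additive on commuting elements. -/
theorem commutator_mul_left (hf : IsTrivialTwoCocycle f) {g h j : G}
    (hgj : Commute g j) (hhj : Commute h j) :
    f (g * h) j - f j (g * h) = (f g j - f j g) + (f h j - f j h) := by
  have h₁ := hf g h j
  have h₂ := hf j g h
  have h₃ := hf g j h
  rw [← hgj.eq] at h₂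
  rw [← hhj.eq] at h₃
  have e₁ := eq_sub_of_add_eq h₁
  have e₂ := eq_sub_of_add_eq' h₂.symm
  have e₃ := eq_sub_of_add_eq h₃
  rw [e₁, e₂, e₃]
  abel

end Basic

section Symmetric

variable {H A : Type*} [CommGroup H] [AddCommGroup A] {f : H → H → A}

/-- The commutator pairing of a cocycle on an abelian group, as a homomorphism in the first
variable. -/
def commutatorHom (hf : IsTrivialTwoCocycle f) (q : H) : H →* Multiplicative A :=
  MonoidHom.mk' (fun p => Multiplicative.ofAdd (f p q - f q p)) fun p p' =>
    congrArg Multiplicative.ofAdd (hf.commutator_mul_left (Commute.all p q) (Commute.all p' q))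

theorem symmetric_of_closure_eq_top (hf : IsTrivialTwoCocycle f) {S : Set H}
    (hS : Subgroup.closure S = ⊤) (h : ∀ p ∈ S, ∀ q ∈ S, f p q = f q p) (p q : H) :
    f p q = f q p := by
  have key : ∀ q, (∀ p ∈ S, f p q = f q p) → ∀ p, f p q = f q p := fun q hq p => by
    have : hf.commutatorHom q = 1 := MonoidHom.eq_of_eqOn_dense hS fun p hp =>
      congrArg Multiplicative.ofAdd (sub_eq_zero.2 (hq p hp))
    exact sub_eq_zero.1 (congrArg Multiplicative.toAdd (DFunLike.congr_fun this p))
  exact key q (fun p hp => (key p (fun r hr => h r hr p hp) q).symm) p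

end Symmetric

end IsTrivialTwoCocycle

/-- The extension of `H` by `A` attached to a function `H → H → A`. -/
@[ext]
structure CocycleExtension {H A : Type*} (f : H → H → A) where
  /-- The component in the kernel. -/
  fst : A
  /-- The component in the quotient. -/
  snd : H

namespace CocycleExtension

variable {H A : Type*} [CommGroup H] [AddCommGroup A] {f : H → H → A}

/-- A symmetric cocycle on an abelian group defines an abelian extension. -/
abbrev addCommGroup (hf : IsTrivialTwoCocycle f) (hs : ∀ p q, f p q = f q p) :
    AddCommGroup (CocycleExtension f) :=
  letI : Add (CocycleExtension f) := ⟨fun x y => ⟨x.1 + y.1 + f x.2 y.2, x.2 * y.2⟩⟩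
  letI : Zero (CocycleExtension f) := ⟨⟨-f 1 1, 1⟩⟩
  letI : Neg (CocycleExtension f) := ⟨fun x => ⟨-x.1 - f x.2⁻¹ x.2 - f 1 1, x.2⁻¹⟩⟩
  { AddGroup.ofLeftAxioms
      (fun x y z => by
        refine CocycleExtension.ext ?_ (mul_assoc _ _ _)
        change x.1 + y.1 + f x.2 y.2 + z.1 + f (x.2 * y.2) z.2 =
          x.1 + (y.1 + z.1 + f y.2 z.2) + f x.2 (y.2 * z.2)
        rw [eq_sub_of_add_eq (hf x.2 y.2 z.2)]
        abel)
      (fun x => by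
        refine CocycleExtension.ext ?_ (one_mul _)
        change -f 1 1 + x.1 + f 1 x.2 = x.1
        rw [hf.map_one_left x.2]
        abel)
      (fun x => by
        refine CocycleExtension.ext ?_ (inv_mul_cancel _)
        change -x.1 - f x.2⁻¹ x.2 - f 1 1 + x.1 + f x.2⁻¹ x.2 = -f 1 1
        abel) with
    add_comm := fun x y => by
      refine CocycleExtension.ext ?_ (mul_comm _ _)
      change x.1 + y.1 + f x.2 y.2 = y.1 + x.1 + f y.2 x.2
      rw [hs, add_comm x.1] }

end CocycleExtension

/-- Symmetric cocycles on an abelian group with values in a divisible group are coboundaries. -/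
theorem IsTrivialTwoCocycle.isTrivialTwoCoboundary_of_symmetric {H A : Type}
    [CommGroup H] [AddCommGroup A] [DivisibleBy A ℤ] {f : H → H → A}
    (hf : IsTrivialTwoCocycle f) (hs : ∀ p q, f p q = f q p) : IsTrivialTwoCoboundary f := by
  let := CocycleExtension.addCommGroup hf hs
  let ι : A →+ CocycleExtension f := AddMonoidHom.mk' (fun a => ⟨a - f 1 1, 1⟩) fun a b => by
    refine CocycleExtension.ext ?_ (one_mul 1).symm
    change a + b - f 1 1 = a - f 1 1 + (b - f 1 1) + f 1 1
    abel
  have hι : Function.Injective ι := fun a b h => sub_left_injective (congrArg (·.fst) h)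
  obtain ⟨r, hr⟩ :=
    (Module.Baer.of_divisible A).extension_property_addMonoidHom ι hι (AddMonoidHom.id A)
  refine ⟨fun p => r ⟨0, p⟩, fun p q => ?_⟩
  have h₁ : (⟨0, p⟩ + ⟨0, q⟩ : CocycleExtension f) = ι (f p q) + ⟨0, p * q⟩ := by
    refine CocycleExtension.ext ?_ (one_mul _).symm
    change 0 + 0 + f p q = f p q - f 1 1 + 0 + f 1 (p * q)
    rw [hf.map_one_left (p * q)]
    abel
  have h₂ := congrArg r h₁
  rw [map_add, map_add, ← AddMonoidHom.comp_apply, hr, AddMonoidHom.id_apply] at h₂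
  rw [sub_add_eq_add_sub, add_comm, h₂, add_sub_cancel_right]

section Transfer

variable {G H : Type*} [Group G] [Group H]

/-- A section of `G → G ⧸ φ.range` turns the action of `G` into an `H`-valued cocycle. -/
theorem exists_cosetCocycle {φ : H →* G} (hφ : Function.Injective φ)
    {s : G ⧸ φ.range → G} (hs : ∀ x, (s x : G ⧸ φ.range) = x) :
    ∃ t : G → G ⧸ φ.range → H, (∀ g x, s (g • x) * φ (t g x) = g * s x) ∧
      ∀ g h x, t (g * h) x = t g (h • x) * t h x := by
  have key : ∀ (g : G) (x : G ⧸ φ.range), ∃ p : H, φ p = (s (g • x))⁻¹ * (g * s x) := fun g x => by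
    rw [← MonoidHom.mem_range, ← QuotientGroup.eq, hs, ← smul_eq_mul, ← MulAction.Quotient.smul_coe,
      hs]
  choose t ht using key
  have ht' : ∀ g x, s (g • x) * φ (t g x) = g * s x := fun g x => by
    rw [ht, mul_inv_cancel_left]
  refine ⟨t, ht', fun g h x => hφ <| mul_left_cancel (a := s ((g * h) • x)) ?_⟩
  rw [ht', map_mul, mul_smul, ← mul_assoc, ht', mul_assoc g (s _), ht', mul_assoc]

variable {A X : Type*} [AddCommGroup A] [MulAction G X] [Fintype X]

/-- Corestriction of `2`-cocycles. -/
theorem IsTrivialTwoCocycle.corestriction {f : H → H → A} (hf : IsTrivialTwoCocycle f)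
    {t : G → X → H} (ht : ∀ g h x, t (g * h) x = t g (h • x) * t h x) :
    IsTrivialTwoCocycle fun g h => ∑ x, f (t g (h • x)) (t h x) := fun g h j => by
  have h₁ : ∑ x, f (t g (h • x)) (t h x) = ∑ x, f (t g ((h * j) • x)) (t h (j • x)) := by
    simpa only [mul_smul, MulAction.toPerm_apply] using
      (Equiv.sum_comp (MulAction.toPerm j) fun x => f (t g (h • x)) (t h x)).symm
  simp only [h₁, ← Finset.sum_add_distrib]
  refine Finset.sum_congr rfl fun x _ => ?_
  rw [ht, ht, mul_smul, hf]

/-- Restriction followed by corestriction is multiplication by the index. -/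
theorem IsTrivialTwoCocycle.index_nsmul {f : G → G → A} (hf : IsTrivialTwoCocycle f)
    {φ : H →* G} (hφ : Function.Injective φ) [φ.range.FiniteIndex]
    (h : IsTrivialTwoCoboundary fun p q => f (φ p) (φ q)) :
    IsTrivialTwoCoboundary fun g h => φ.range.index • f g h := by
  obtain ⟨y, hy⟩ := h
  obtain ⟨t, ht, htm⟩ := exists_cosetCocycle hφ (s := Quotient.out) QuotientGroup.out_eq'
  let := φ.range.fintypeQuotientOfFiniteIndex
  set s : G ⧸ φ.range → G := Quotient.out
  refine ⟨fun g => ∑ x, (y (t g x) + f g (s x) - f (s (g • x)) (φ (t g x))), fun g h => ?_⟩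
  dsimp only
  rw [← Equiv.sum_comp (MulAction.toPerm h)
      fun x => y (t g x) + f g (s x) - f (s (g • x)) (φ (t g x)),
    Subgroup.index_eq_card, Nat.card_eq_fintype_card, ← Finset.card_univ, ← Finset.sum_const,
    ← Finset.sum_sub_distrib, ← Finset.sum_add_distrib]
  refine Finset.sum_congr rfl fun x _ => ?_
  rw [MulAction.toPerm_apply, htm]
  have h₀ := hy (t g (h • x)) (t h x)
  have h₁ := hf g h (s x)
  have h₂ := hf g (s (h • x)) (φ (t h x))
  have h₃ := hf (s (g • h • x)) (φ (t g (h • x))) (φ (t h x))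
  rw [ht] at h₂ h₃
  rw [mul_smul, map_mul]
  dsimp only at h₀
  linear_combination (norm := module) h₀ - h₁ + h₂ - h₃

end Transfer

section ElementaryAbelian

/-- The determinant form on the elementary abelian group of order nine. -/
def detForm (p q : Multiplicative (ZMod 3 × ZMod 3)) : ZMod 3 :=
  p.toAdd.1 * q.toAdd.2 - p.toAdd.2 * q.toAdd.1

theorem isTrivialTwoCocycle_detForm : IsTrivialTwoCocycle detForm := fun p q r => by
  simp only [detForm, toAdd_mul, Prod.fst_add, Prod.snd_add]
  ring

theorem detForm_swap (p q : Multiplicative (ZMod 3 × ZMod 3)) :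
    detForm q p = -detForm p q := by
  simp only [detForm]
  ring

theorem exists_pow_mul_pow_eq_one_of_detForm_eq_zero (p q : Multiplicative (ZMod 3 × ZMod 3))
    (h : detForm p q = 0) : ∃ i j : Fin 3, (i ≠ 0 ∨ j ≠ 0) ∧ p ^ (i : ℕ) * q ^ (j : ℕ) = 1 := by
  revert p q
  decide +kernel

theorem detForm_eq_zero_of_pow_mul_pow_eq_one (p q : Multiplicative (ZMod 3 × ZMod 3))
    (i j : Fin 3) (hij : i ≠ 0 ∨ j ≠ 0) (h : p ^ (i : ℕ) * q ^ (j : ℕ) = 1) :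
    detForm p q = 0 := by
  revert p q i j
  decide +kernel

theorem exists_pow_mul_pow_eq_of_detForm_ne_zero (p q : Multiplicative (ZMod 3 × ZMod 3))
    (h : detForm p q ≠ 0) (r : Multiplicative (ZMod 3 × ZMod 3)) :
    ∃ i j : Fin 3, p ^ (i : ℕ) * q ^ (j : ℕ) = r := by
  revert p q r
  decide +kernel

variable {G : Type*} [Group G] {φ : Multiplicative (ZMod 3 × ZMod 3) →* G}

/-- A coset cocycle compatible with the orbits of the subgroup `φ.range` on its own cosets. -/
theorem exists_adapted_cosetCocycle (hφ : Function.Injective φ) :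
    ∃ t : G → G ⧸ φ.range → Multiplicative (ZMod 3 × ZMod 3),
      (∀ g h x, t (g * h) x = t g (h • x) * t h x) ∧
      (∀ x, (¬ ∀ p, φ p • x = x) → ∀ p q, detForm (t (φ p) (φ q • x)) (t (φ q) x) = 0) ∧
      ∀ x, (∀ p, φ p • x = x) → ∃ n : G, ∀ p, φ (t (φ p) x) = n⁻¹ * φ p * n := by
  let := MulAction.compHom (G ⧸ φ.range) φ
  have hsmul : ∀ p (x : G ⧸ φ.range), p • x = φ p • x := fun _ _ => rfl
  let r : G ⧸ φ.range → G ⧸ φ.range := fun x =>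
    (Quotient.mk (MulAction.orbitRel (Multiplicative (ZMod 3 × ZMod 3)) (G ⧸ φ.range)) x).out
  have hr : ∀ p x, r (φ p • x) = r x := fun p x =>
    congrArg Quotient.out (Quotient.sound ⟨p, rfl⟩)
  have hrx : ∀ x, ∃ p, φ p • r x = x := fun x =>
    (MulAction.orbitRel _ _).symm (Quotient.mk_out x)
  choose c hc using hrx
  let o : G ⧸ φ.range → G := Quotient.out
  have ho : ∀ x, (o x : G ⧸ φ.range) = x := QuotientGroup.out_eq'
  obtain ⟨t, ht, htm⟩ := exists_cosetCocycle hφ (s := fun x => φ (c x) * o (r x)) fun x => by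
    rw [← smul_eq_mul, ← MulAction.Quotient.smul_coe, ho, hc]
  have key : ∀ p x, φ (t (φ p) x) = (o (r x))⁻¹ * φ ((c (φ p • x))⁻¹ * p * c x) * o (r x) :=
    fun p x => by
      have h := ht (φ p) x
      rw [hr] at h
      rw [map_mul, map_mul, map_inv]
      refine mul_left_cancel (a := φ (c (φ p • x)) * o (r x)) (h.trans ?_)
      group
  have hstab : ∀ p x, φ ((c (φ p • x))⁻¹ * p * c x) • r x = r x := fun p x => by
    rw [map_mul, map_mul, map_inv, mul_smul, mul_smul, hc, inv_smul_eq_iff, ← hr p, hc]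
  refine ⟨t, htm, fun x hx p q => ?_, fun x hx => ⟨o (r x), fun p => ?_⟩⟩
  · by_contra h
    have k₁ := key p (φ q • x)
    have k₂ := key q x
    have s₁ := hstab p (φ q • x)
    have s₂ := hstab q x
    rw [hr] at k₁ s₁
    set a := (c (φ p • φ q • x))⁻¹ * p * c (φ q • x)
    set b := (c (φ q • x))⁻¹ * q * c x
    have hab : detForm a b ≠ 0 := fun h₀ => h <| by
      obtain ⟨i, j, hij, hz⟩ := exists_pow_mul_pow_eq_one_of_detForm_eq_zero a b h₀
      refine detForm_eq_zero_of_pow_mul_pow_eq_one _ _ i j hij (hφ ?_)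
      have conj_pow' : ∀ (u v : G) (k : ℕ), (u⁻¹ * v * u) ^ k = u⁻¹ * v ^ k * u := fun u v k => by
        simpa using conj_pow (i := k) (a := u⁻¹) (b := v)
      rw [map_mul, map_pow, map_pow, k₁, k₂, conj_pow', conj_pow', map_one, ← map_pow, ← map_pow]
      calc _ = (o (r x))⁻¹ * φ (a ^ (i : ℕ) * b ^ (j : ℕ)) * o (r x) := by rw [map_mul]; group
        _ = 1 := by rw [hz, map_one]; group
    have hfix : ∀ p, φ p • r x = r x := fun p => by
      obtain ⟨i, j, rfl⟩ := exists_pow_mul_pow_eq_of_detForm_ne_zero a b hab p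
      have ha : a ∈ MulAction.stabilizer (Multiplicative (ZMod 3 × ZMod 3)) (r x) := s₁
      have hb : b ∈ MulAction.stabilizer (Multiplicative (ZMod 3 × ZMod 3)) (r x) := s₂
      exact mul_mem (pow_mem ha i) (pow_mem hb j)
    have hxr : r x = x := by rw [← hfix (c x), hc]
    exact hx (hxr ▸ hfix)
  · rw [key, hx, mul_comm (c x)⁻¹, inv_mul_cancel_right]

/-- If every conjugation fixing the elementary abelian subgroup `φ.range` preserves the
determinant form, then the form extends to a cocycle up to corestriction. -/
theorem exists_cocycle_of_detForm_invariant (hφ : Function.Injective φ) [φ.range.FiniteIndex]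
    (hindex : ¬ 3 ∣ φ.range.index) {a b : Multiplicative (ZMod 3 × ZMod 3)}
    (hinv : ∀ n v w, φ v = n⁻¹ * φ a * n → φ w = n⁻¹ * φ b * n → detForm v w = 1) :
    ∃ F : G → G → ZMod 3, IsTrivialTwoCocycle F ∧ F (φ a) (φ b) ≠ F (φ b) (φ a) := by
  classical
  obtain ⟨t, htm, hnf, hfix⟩ := exists_adapted_cosetCocycle hφ
  let := φ.range.fintypeQuotientOfFiniteIndex
  let := MulAction.compHom (G ⧸ φ.range) φ
  refine ⟨_, isTrivialTwoCocycle_detForm.corestriction htm, ?_⟩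
  have hsum : ∀ p q, ∑ x, detForm (t (φ p) (φ q • x)) (t (φ q) x) =
      ∑ x with ∀ p, φ p • x = x, detForm (t (φ p) x) (t (φ q) x) := fun p q => by
    rw [Finset.sum_filter]
    refine Finset.sum_congr rfl fun x _ => ?_
    split_ifs with h
    · rw [h]
    · exact hnf x h p q
  have hone : ∀ x, (∀ p, φ p • x = x) → detForm (t (φ a) x) (t (φ b) x) = 1 := fun x hx => by
    obtain ⟨n, hn⟩ := hfix x hx
    exact hinv n _ _ (hn a) (hn b)
  have hp : IsPGroup 3 (Multiplicative (ZMod 3 × ZMod 3)) :=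
    IsPGroup.of_card (n := 2) (by simp)
  have hcard := hp.card_modEq_card_fixedPoints (G ⧸ φ.range)
  have hF : ∑ x with ∀ p, φ p • x = x, detForm (t (φ a) x) (t (φ b) x) =
      (φ.range.index : ZMod 3) := by
    rw [Finset.sum_congr rfl fun x hx => hone x (Finset.mem_filter.1 hx).2, Finset.sum_const,
      nsmul_one, ← Fintype.card_subtype, ← Nat.card_eq_fintype_card, Subgroup.index_eq_card]
    exact ((ZMod.natCast_eq_natCast_iff _ _ _).2 hcard).symm
  have hF' : (φ.range.index : ZMod 3) ≠ 0 := by rwa [Ne, ZMod.natCast_eq_zero_iff]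
  rw [hsum, hsum, Finset.sum_congr rfl fun x _ => detForm_swap (t (φ a) x) (t (φ b) x),
    Finset.sum_neg_distrib, hF]
  generalize (φ.range.index : ZMod 3) = i at hF'
  revert i
  decide

end ElementaryAbelian

section SecondCohomology

open groupCohomology

variable {G A : Type} [Group G] [AddCommGroup A]

theorem isTrivialTwoCocycle_curry_iff (f : G × G → A) :
    IsTrivialTwoCocycle (fun g h => f (g, h)) ↔ f ∈ cocycles₂ (Rep.trivial ℤ G A) :=
  (mem_cocycles₂_iff (A := Rep.trivial ℤ G A) f).symm

theorem isTrivialTwoCoboundary_curry_iff (f : G × G → A) :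
    IsTrivialTwoCoboundary (fun g h => f (g, h)) ↔ f ∈ coboundaries₂ (Rep.trivial ℤ G A) :=
  ⟨fun ⟨x, hx⟩ => ⟨x, funext fun p => hx p.1 p.2⟩,
    fun ⟨x, hx⟩ => ⟨x, fun g h => congrFun hx (g, h)⟩⟩

theorem IsTrivialTwoCocycle.three_nsmul_commutator {f : G → G → A} (hf : IsTrivialTwoCocycle f)
    {a b : G} (hab : Commute a b) (ha : a ^ 3 = 1) : 3 • (f a b - f b a) = 0 := by
  have h₁ := hf.commutator_mul_left hab hab
  have h₂ := hf.commutator_mul_left (hab.mul_left hab) hab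
  have h₃ := hf.commutator_mul_left (Commute.one_left b) (Commute.one_left b)
  rw [← pow_two, ← pow_succ, ha, pow_two, h₁] at h₂
  rw [mul_one, left_eq_add] at h₃
  rw [succ_nsmul, two_nsmul, ← h₂, h₃]

/-- The value of the commutator pairing at a pair of elements, as a homomorphism on cocycles. -/
def commutatorEval (a b : G) : cocycles₂ (Rep.trivial ℤ G A) →+ A :=
  AddMonoidHom.mk' (fun f => f.1 (a, b) - f.1 (b, a)) fun f f' =>
    add_sub_add_comm (f.1 (a, b)) (f'.1 (a, b)) (f.1 (b, a)) (f'.1 (b, a))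

theorem IsTrivialTwoCoboundary.commutator_eq {f : G → G → A} (hf : IsTrivialTwoCoboundary f)
    {a b : G} (hab : Commute a b) : f a b = f b a := by
  obtain ⟨x, hx⟩ := hf
  rw [← hx, ← hx, hab.eq]
  abel

/-- If classes are detected by the commutator pairing at a pair of commuting elements of order
three, then `H²` has order three. -/
theorem natCard_H2_eq_three {T : AddSubgroup A} (hT : Nat.card T = 3)
    (hT' : ∀ x, x ∈ T ↔ 3 • x = 0) {a b : G} (hab : Commute a b) (ha : a ^ 3 = 1)
    (hdetect : ∀ f : G → G → A, IsTrivialTwoCocycle f → f a b = f b a → IsTrivialTwoCoboundary f)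
    (hex : ∃ F : G → G → ZMod 3, IsTrivialTwoCocycle F ∧ F a b ≠ F b a) :
    Nat.card (H2 (Rep.trivial ℤ G A)) = 3 := by
  let π : cocycles₂ (Rep.trivial ℤ G A) →+ H2 (Rep.trivial ℤ G A) :=
    (H2π (Rep.trivial ℤ G A)).hom.toAddMonoidHom
  have hπ : Function.Surjective π := fun x => H2_induction_on x fun f => ⟨f, rfl⟩
  have hker : π.ker = (commutatorEval (A := A) a b).ker := by
    ext f
    have hπf : π f = 0 ↔ ⇑f ∈ coboundaries₂ (Rep.trivial ℤ G A) := H2π_eq_zero_iff f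
    have hf := (isTrivialTwoCocycle_curry_iff f.1).2 f.2
    rw [AddMonoidHom.mem_ker, AddMonoidHom.mem_ker, hπf]
    refine (isTrivialTwoCoboundary_curry_iff f.1).symm.trans ⟨fun h => ?_, fun h => ?_⟩
    · exact sub_eq_zero.2 (h.commutator_eq hab)
    · exact hdetect _ hf (sub_eq_zero.1 h)
  have hrange : (commutatorEval (A := A) a b).range ≤ T := by
    rintro _ ⟨f, rfl⟩
    exact (hT' _).2
      (((isTrivialTwoCocycle_curry_iff f.1).2 f.2).three_nsmul_commutator hab ha)
  have hne : (commutatorEval (A := A) a b).range ≠ ⊥ := fun hbot => by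
    obtain ⟨F, hF, hFab⟩ := hex
    have : Finite T := Nat.finite_of_card_ne_zero (by rw [hT]; decide)
    have : Nontrivial T := Finite.one_lt_card_iff_nontrivial.1 (by rw [hT]; decide)
    obtain ⟨⟨ζ, hζT⟩, hζ⟩ := exists_ne (0 : T)
    have hζ' : ζ ≠ 0 := fun h => hζ (Subtype.ext h)
    let χ : ZMod 3 →+ A := ZMod.lift 3 ⟨zmultiplesHom A ζ, by
      simpa [zmultiplesHom_apply, ← natCast_zsmul] using (hT' ζ).1 hζT⟩
    have hχ : Function.Injective χ := by
      refine (ZMod.lift_injective _).2 fun m hm => ?_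
      rw [ZMod.intCast_zmod_eq_zero_iff_dvd]
      have h3 : addOrderOf ζ = 3 := addOrderOf_eq_prime ((hT' ζ).1 hζT) hζ'
      rw [← h3]
      exact addOrderOf_dvd_iff_zsmul_eq_zero.2 hm
    have hχF : IsTrivialTwoCocycle fun g h => χ (F g h) := fun g h j => by
      rw [← map_add, hF, map_add]
    let c : cocycles₂ (Rep.trivial ℤ G A) :=
      ⟨fun p => χ (F p.1 p.2), (isTrivialTwoCocycle_curry_iff _).1 hχF⟩
    have hc : commutatorEval a b c ∈ (commutatorEval (A := A) a b).range := ⟨c, rfl⟩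
    rw [hbot, AddSubgroup.mem_bot] at hc
    exact hFab (hχ (sub_eq_zero.1 hc))
  have e : H2 (Rep.trivial ℤ G A) ≃+ (commutatorEval (A := A) a b).range :=
    (QuotientAddGroup.quotientKerEquivOfSurjective π hπ).symm.trans <|
      (QuotientAddGroup.quotientAddEquivOfEq hker).trans
        (QuotientAddGroup.quotientKerEquivRange _)
  rw [Nat.card_congr e.toEquiv]
  have hdvd := AddSubgroup.card_dvd_of_le hrange
  rw [hT] at hdvd
  exact ((Nat.dvd_prime Nat.prime_three).1 hdvd).resolve_left fun h =>
    hne (AddSubgroup.eq_bot_of_card_eq _ h)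

/-- A cocycle that is symmetric on generators of an abelian subgroup is killed by its index. -/
theorem IsTrivialTwoCocycle.index_nsmul_of_closure [DivisibleBy A ℤ] {f : G → G → A}
    (hf : IsTrivialTwoCocycle f) {H : Type} [CommGroup H] {φ : H →* G}
    (hφ : Function.Injective φ) [φ.range.FiniteIndex] {S : Set H}
    (hS : Subgroup.closure S = ⊤) (h : ∀ p ∈ S, ∀ q ∈ S, f (φ p) (φ q) = f (φ q) (φ p)) :
    IsTrivialTwoCoboundary fun g h => φ.range.index • f g h :=
  hf.index_nsmul hφ <| (hf.comp_monoidHom φ).isTrivialTwoCoboundary_of_symmetric <|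
    (hf.comp_monoidHom φ).symmetric_of_closure_eq_top hS h

theorem IsTrivialTwoCocycle.natCard_div_nsmul_of_cyclic [Finite G] [DivisibleBy A ℤ]
    {f : G → G → A} (hf : IsTrivialTwoCocycle f) (g : G) :
    IsTrivialTwoCoboundary fun x y => (Nat.card G / orderOf g) • f x y := by
  let : CommGroup (Subgroup.zpowers g) := IsCyclic.commGroup
  have h := hf.index_nsmul_of_closure (H := Subgroup.zpowers g) (φ := (Subgroup.zpowers g).subtype)
    (Subgroup.subtype_injective _) (S := {⟨g, Subgroup.mem_zpowers g⟩})
    (by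
      rw [← Subgroup.zpowers_eq_closure, Subgroup.eq_top_iff']
      rintro ⟨_, k, rfl⟩
      exact ⟨k, Subtype.ext (Subgroup.coe_zpow _ _ _)⟩)
    (by rintro _ rfl _ rfl; rfl)
  have hcard := (Subgroup.zpowers g).index_mul_card
  rw [Nat.card_zpowers] at hcard
  rwa [Subgroup.range_subtype, Nat.eq_div_of_mul_eq_left (orderOf_pos g).ne' hcard] at h

theorem IsTrivialTwoCoboundary.gcd_nsmul {f : G → G → A} {m n : ℕ}
    (hm : IsTrivialTwoCoboundary fun x y => m • f x y)
    (hn : IsTrivialTwoCoboundary fun x y => n • f x y) :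
    IsTrivialTwoCoboundary fun x y => m.gcd n • f x y := by
  obtain ⟨u, hu⟩ := hm
  obtain ⟨v, hv⟩ := hn
  refine ⟨fun g => m.gcdA n • u g + m.gcdB n • v g, fun g h => ?_⟩
  dsimp only at hu hv ⊢
  rw [← natCast_zsmul, Nat.gcd_eq_gcd_ab, add_smul, mul_comm (m : ℤ), mul_comm (n : ℤ), mul_smul,
    mul_smul, natCast_zsmul, natCast_zsmul, ← hu, ← hv]
  module

theorem IsTrivialTwoCoboundary.of_nsmul [DivisibleBy A ℤ] {f : G → G → A} {n : ℕ}
    (hn : ∀ x : A, n • x = 0 → x = 0) (hf : IsTrivialTwoCoboundary fun x y => n • f x y) :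
    IsTrivialTwoCoboundary f := by
  obtain ⟨u, hu⟩ := hf
  have hdiv : ∀ x : A, ∃ y, n • y = x := fun x => by
    rcases eq_or_ne n 0 with rfl | h0
    · exact ⟨0, by rw [hn x (zero_nsmul x), smul_zero]⟩
    · exact ⟨DivisibleBy.div x (n : ℤ), by
        rw [← natCast_zsmul, DivisibleBy.div_cancel x (Int.natCast_ne_zero.2 h0)]⟩
  choose d hd using hdiv
  dsimp only at hu
  refine ⟨fun g => d (u g), fun g h => sub_eq_zero.1 (hn _ ?_)⟩
  rw [smul_sub, smul_add, smul_sub, hd, hd, hd, hu, sub_self]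

end SecondCohomology

section Units

variable (k : Type) [Field k] [IsAlgClosed k]

/-- The unit group of an algebraically closed field is divisible. -/
noncomputable instance : DivisibleBy (Additive kˣ) ℤ :=
  have : DivisibleBy (Additive kˣ) ℕ := divisibleByOfSMulRightSurj _ _ fun {n} hn x => by
    obtain ⟨z, hz⟩ := IsAlgClosed.exists_pow_nat_eq (x.toMul : k) (Nat.pos_of_ne_zero hn)
    have hz0 : z ≠ 0 := fun h => x.toMul.ne_zero (by rw [← hz, h, zero_pow hn])
    exact ⟨Additive.ofMul (Units.mk0 z hz0), congrArg Additive.ofMul (Units.ext hz)⟩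
  AddGroup.divisibleByIntOfDivisibleByNat _

theorem two_pow_nsmul_units_eq_zero (k : Type) [Field k] [CharP k 2] (n : ℕ)
    (x : Additive kˣ) (h : 2 ^ n • x = 0) : x = 0 := by
  have : ExpChar k 2 := ExpChar.prime Nat.prime_two
  have h' : (x.toMul : k) ^ 2 ^ n = 1 := congrArg (fun y : Additive kˣ => (y.toMul : k)) h
  have : (x.toMul : k) = 1 := iterateFrobenius_inj k 2 n (by
    rw [iterateFrobenius_def, h', map_one])
  exact congrArg Additive.ofMul (Units.ext this)

theorem natCard_three_torsion_units [CharP k 2] :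
    Nat.card (Subgroup.toAddSubgroup (rootsOfUnity 3 k)) = 3 := by
  have : NeZero ((3 : ℕ) : k) := ⟨fun h => by
    have := (CharP.cast_eq_zero_iff k 2 3).1 h
    omega⟩
  exact HasEnoughRootsOfUnity.natCard_rootsOfUnity k 3

end Units

section Alternating

open Equiv

/-- The subgroup of `A₆` generated by two disjoint three-cycles. -/
def threeCyclesHom : Multiplicative (ZMod 3 × ZMod 3) →* alternatingGroup (Fin 6) :=
  MonoidHom.mk' (fun v =>
    (⟨swap 0 1 * swap 1 2, Perm.mem_alternatingGroup.2 (by decide)⟩ : alternatingGroup (Fin 6)) ^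
      v.toAdd.1.val *
    (⟨swap 3 4 * swap 4 5, Perm.mem_alternatingGroup.2 (by decide)⟩ : alternatingGroup (Fin 6)) ^
      v.toAdd.2.val) (by decide +kernel)

theorem threeCyclesHom_injective : Function.Injective threeCyclesHom := by
  rw [injective_iff_map_eq_one]
  decide +kernel

/-- The inclusion of `A₆` in `A₇` as the stabilizer of the last point. -/
def alternatingInclusion : alternatingGroup (Fin 6) →* alternatingGroup (Fin 7) :=
  ((Perm.extendDomainHom (finSuccAboveEquiv (Fin.last 6))).comp
    (alternatingGroup (Fin 6)).subtype).codRestrict _ fun σ => by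
      exact Perm.mem_alternatingGroup.2
        ((Perm.sign_extendDomain _ _).trans (Perm.mem_alternatingGroup.1 σ.2))

theorem alternatingInclusion_injective : Function.Injective alternatingInclusion := fun _ _ h =>
  Subtype.ext (Perm.extendDomainHom_injective (finSuccAboveEquiv (Fin.last 6))
    (congrArg Subtype.val h))

/-- The points of the first three-cycle. -/
def firstOrbit (i : ZMod 3) : Fin 7 := ![0, 1, 2] i

/-- The points of the second three-cycle. -/
def secondOrbit (i : ZMod 3) : Fin 7 := ![3, 4, 5] i

theorem firstOrbit_injective : Function.Injective firstOrbit := by decide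

theorem secondOrbit_injective : Function.Injective secondOrbit := by decide

theorem threeCycles_apply_firstOrbit (v : Multiplicative (ZMod 3 × ZMod 3)) (k : ZMod 3) :
    (alternatingInclusion (threeCyclesHom v)).1 (firstOrbit k) = firstOrbit (k + v.toAdd.1) := by
  revert v k
  decide +kernel

theorem threeCycles_apply_secondOrbit (v : Multiplicative (ZMod 3 × ZMod 3)) (k : ZMod 3) :
    (alternatingInclusion (threeCyclesHom v)).1 (secondOrbit k) = secondOrbit (k + v.toAdd.2) := by
  revert v k
  decide +kernel

/-- The two standard generators of the elementary abelian group of order nine. -/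
abbrev gen (i j : ZMod 3) : Multiplicative (ZMod 3 × ZMod 3) := Multiplicative.ofAdd (i, j)

set_option synthInstance.maxHeartbeats 200000 in
set_option synthInstance.maxSize 1000 in
/-- An orbit of the three-cycles, parametrised equivariantly. -/
theorem eq_orbit_of_equivariant (p : ZMod 3 → Fin 7) (hp : ∀ k l, p k = p l → k = l) (i j : ZMod 3)
    (hi : ∀ k, p (k + i) = (alternatingInclusion (threeCyclesHom (gen 1 0))).1 (p k))
    (hj : ∀ k, p (k + j) = (alternatingInclusion (threeCyclesHom (gen 0 1))).1 (p k)) :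
    (j = 0 ∧ i ≠ 0 ∧ ∃ c, ∀ k, p k = firstOrbit (c + i * k)) ∨
      (i = 0 ∧ j ≠ 0 ∧ ∃ c, ∀ k, p k = secondOrbit (c + j * k)) := by
  revert p i j
  decide +kernel

theorem mul_eq_of_sign_eq_one {σ : Perm (Fin 7)} (hσ : Perm.sign σ = 1) {i j c d : ZMod 3}
    (hi : i ≠ 0) (hj : j ≠ 0) (h₁ : ∀ k, σ (firstOrbit k) = firstOrbit (c + i * k))
    (h₂ : ∀ k, σ (secondOrbit k) = secondOrbit (d + j * k)) : i * j = 1 := by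
  have key : ∀ i j c d : ZMod 3, i ≠ 0 → j ≠ 0 → ∀ t : Fin 7, ∀ f : Fin 7 → Fin 7,
      f = ![firstOrbit c, firstOrbit (c + i), firstOrbit (c + i * 2), secondOrbit d,
        secondOrbit (d + j), secondOrbit (d + j * 2), t] → (∀ x y, f x = f y → x = y) →
      (∏ y, ∏ x ∈ Finset.Iio y, if f x < f y then (1 : ℤˣ) else -1) = 1 → i * j = 1 := by
    simp only [forall_eq]
    decide +kernel
  refine key i j c d hi hj (σ 6) σ ?_ (fun x y h => σ.injective h)
    (σ.sign_eq_prod_prod_Iio ▸ hσ)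
  have a₁ := h₁ 0
  have a₂ := h₁ 1
  have a₃ := h₁ 2
  have b₁ := h₂ 0
  have b₂ := h₂ 1
  have b₃ := h₂ 2
  rw [mul_zero, add_zero] at a₁ b₁
  rw [mul_one] at a₂ b₂
  funext x
  fin_cases x <;> first | assumption | rfl

theorem mul_eq_of_sign_eq_one_of_swap {σ : Perm (Fin 7)} (hσ : Perm.sign σ = 1)
    {i j c d : ZMod 3} (hi : i ≠ 0) (hj : j ≠ 0)
    (h₁ : ∀ k, σ (firstOrbit k) = secondOrbit (c + i * k))
    (h₂ : ∀ k, σ (secondOrbit k) = firstOrbit (d + j * k)) : i * j = -1 := by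
  have key : ∀ i j c d : ZMod 3, i ≠ 0 → j ≠ 0 → ∀ t : Fin 7, ∀ f : Fin 7 → Fin 7,
      f = ![secondOrbit c, secondOrbit (c + i), secondOrbit (c + i * 2), firstOrbit d,
        firstOrbit (d + j), firstOrbit (d + j * 2), t] → (∀ x y, f x = f y → x = y) →
      (∏ y, ∏ x ∈ Finset.Iio y, if f x < f y then (1 : ℤˣ) else -1) = 1 → i * j = -1 := by
    simp only [forall_eq]
    decide +kernel
  refine key i j c d hi hj (σ 6) σ ?_ (fun x y h => σ.injective h)
    (σ.sign_eq_prod_prod_Iio ▸ hσ)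
  have a₁ := h₁ 0
  have a₂ := h₁ 1
  have a₃ := h₁ 2
  have b₁ := h₂ 0
  have b₂ := h₂ 1
  have b₃ := h₂ 2
  rw [mul_zero, add_zero] at a₁ b₁
  rw [mul_one] at a₂ b₂
  funext x
  fin_cases x <;> first | assumption | rfl

theorem firstOrbit_ne_secondOrbit (k l : ZMod 3) : firstOrbit k ≠ secondOrbit l := by
  revert k l
  decide

/-- Conjugation in `A₇` preserves the determinant form on the Sylow `3`-subgroup. -/
theorem detForm_eq_one_of_conj (n : alternatingGroup (Fin 7))
    (v w : Multiplicative (ZMod 3 × ZMod 3))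
    (hv : alternatingInclusion (threeCyclesHom v) =
      n⁻¹ * alternatingInclusion (threeCyclesHom (gen 1 0)) * n)
    (hw : alternatingInclusion (threeCyclesHom w) =
      n⁻¹ * alternatingInclusion (threeCyclesHom (gen 0 1)) * n) :
    detForm v w = 1 := by
  have conj : ∀ u u', alternatingInclusion (threeCyclesHom u) =
      n⁻¹ * alternatingInclusion (threeCyclesHom u') * n → ∀ x,
      n.1 ((alternatingInclusion (threeCyclesHom u)).1 x) =
        (alternatingInclusion (threeCyclesHom u')).1 (n.1 x) := fun u u' h x => by
    rw [h]
    simp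
  have hn : Perm.sign n.1 = 1 := Perm.mem_alternatingGroup.1 n.2
  have p := eq_orbit_of_equivariant (fun k => n.1 (firstOrbit k))
    (fun k l h => firstOrbit_injective (n.1.injective h)) v.toAdd.1 w.toAdd.1
    (fun k => by rw [← threeCycles_apply_firstOrbit, conj _ _ hv])
    (fun k => by rw [← threeCycles_apply_firstOrbit, conj _ _ hw])
  have q := eq_orbit_of_equivariant (fun k => n.1 (secondOrbit k))
    (fun k l h => secondOrbit_injective (n.1.injective h)) v.toAdd.2 w.toAdd.2
    (fun k => by rw [← threeCycles_apply_secondOrbit, conj _ _ hv])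
    (fun k => by rw [← threeCycles_apply_secondOrbit, conj _ _ hw])
  have ne : ∀ k l, n.1 (firstOrbit k) ≠ n.1 (secondOrbit l) := fun k l h =>
    firstOrbit_ne_secondOrbit k l (n.1.injective h)
  have solve : ∀ c d i : ZMod 3, i ≠ 0 → ∃ k, c + i * k = d := by decide
  unfold detForm
  rcases p with ⟨p₀, p₁, c, hc⟩ | ⟨p₀, p₁, c, hc⟩ <;>
    rcases q with ⟨q₀, q₁, d, hd⟩ | ⟨q₀, q₁, d, hd⟩
  · obtain ⟨k, hk⟩ := solve c (d + v.toAdd.2 * 0) _ p₁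
    exact absurd (by rw [hc, hd, hk]) (ne k 0)
  · rw [p₀, mul_zero, sub_zero, mul_eq_of_sign_eq_one hn p₁ q₁ hc hd]
  · rw [p₀, zero_mul, zero_sub, mul_comm, mul_eq_of_sign_eq_one_of_swap hn p₁ q₁ hc hd, neg_neg]
  · obtain ⟨k, hk⟩ := solve c (d + w.toAdd.2 * 0) _ p₁
    exact absurd (by rw [hc, hd, hk]) (ne k 0)

theorem closure_gen_eq_top :
    Subgroup.closure ({gen 1 0, gen 0 1} : Set (Multiplicative (ZMod 3 × ZMod 3))) = ⊤ := by
  refine (Subgroup.eq_top_iff' _).2 fun v => ?_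
  have h₁ := Subgroup.subset_closure (Set.mem_insert (gen 1 0) {gen 0 1})
  have h₂ := Subgroup.subset_closure (Set.mem_insert_of_mem (gen 1 0) (Set.mem_singleton (gen 0 1)))
  have hv : gen 1 0 ^ v.toAdd.1.val * gen 0 1 ^ v.toAdd.2.val = v := by
    revert v
    decide +kernel
  exact hv ▸ Subgroup.mul_mem _ (Subgroup.pow_mem _ h₁ v.toAdd.1.val)
    (Subgroup.pow_mem _ h₂ v.toAdd.2.val)

theorem index_range_of_injective {G : Type} [Group G] [Finite G]
    {φ : Multiplicative (ZMod 3 × ZMod 3) →* G} (hφ : Function.Injective φ) :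
    φ.range.index = Nat.card G / 9 := by
  have h := φ.range.index_mul_card
  rw [Nat.card_congr (MonoidHom.ofInjective hφ).symm.toEquiv] at h
  have h9 : Nat.card (Multiplicative (ZMod 3 × ZMod 3)) = 9 := by simp
  rw [h9] at h
  omega

end Alternating

section Final

variable {k : Type} [Field k] [IsAlgClosed k]

/-- If the Sylow `3`-subgroup of `G` is elementary abelian of order nine and carries an invariant
determinant form, and cohomology is killed by `72`, then `H²(G, kˣ)` has order three. -/
theorem natCard_H2_units_eq_three [CharP k 2] {G : Type} [Group G] [Finite G]
    {φ : Multiplicative (ZMod 3 × ZMod 3) →* G} (hφ : Function.Injective φ)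
    (hcard : (Nat.card G / 9).gcd 72 = 8)
    (h72 : ∀ f : G → G → Additive kˣ, IsTrivialTwoCocycle f →
      IsTrivialTwoCoboundary fun x y => 72 • f x y)
    (hex : ∃ F : G → G → ZMod 3, IsTrivialTwoCocycle F ∧
      F (φ (gen 1 0)) (φ (gen 0 1)) ≠ F (φ (gen 0 1)) (φ (gen 1 0))) :
    Nat.card (groupCohomology.H2 (Rep.trivial ℤ G (Additive kˣ))) = 3 := by
  refine natCard_H2_eq_three (natCard_three_torsion_units k) (fun x => Iff.rfl)
    ((Commute.all (gen 1 0) (gen 0 1)).map φ) ?_ (fun f hf hab => ?_) hex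
  · rw [← map_pow, show gen 1 0 ^ 3 = 1 by decide, map_one]
  · have h := hf.index_nsmul_of_closure hφ closure_gen_eq_top (by
      rintro _ (rfl | rfl) _ (rfl | rfl)
      exacts [rfl, hab, hab.symm, rfl])
    rw [index_range_of_injective hφ] at h
    have h8 := h.gcd_nsmul (h72 f hf)
    rw [hcard] at h8
    exact h8.of_nsmul (two_pow_nsmul_units_eq_zero k 3)

theorem natCard_alternatingGroup_six : Nat.card (alternatingGroup (Fin 6)) = 360 := by
  rw [nat_card_alternatingGroup, Nat.card_fin]
  rfl

theorem natCard_alternatingGroup_seven : Nat.card (alternatingGroup (Fin 7)) = 2520 := by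
  rw [nat_card_alternatingGroup, Nat.card_fin]
  rfl

/-- A five-cycle in `A₆`. -/
def fiveCycle : alternatingGroup (Fin 6) :=
  ⟨Equiv.swap 0 1 * Equiv.swap 1 2 * Equiv.swap 2 3 * Equiv.swap 3 4,
    Equiv.Perm.mem_alternatingGroup.2 (by decide)⟩

theorem orderOf_fiveCycle : orderOf fiveCycle = 5 :=
  have : Fact (Nat.Prime 5) := ⟨Nat.prime_five⟩
  orderOf_eq_prime (by decide +kernel) (by decide +kernel)

/-- A seven-cycle in `A₇`. -/
def sevenCycle : alternatingGroup (Fin 7) :=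
  ⟨finRotate 7, Equiv.Perm.mem_alternatingGroup.2 (by decide)⟩

theorem orderOf_sevenCycle : orderOf sevenCycle = 7 :=
  have : Fact (Nat.Prime 7) := ⟨Nat.prime_seven⟩
  orderOf_eq_prime (by decide +kernel) (by decide +kernel)

theorem nsmul_cocycle_alternatingGroup_six {f : _ → _ → Additive kˣ}
    (hf : IsTrivialTwoCocycle (G := alternatingGroup (Fin 6)) f) :
    IsTrivialTwoCoboundary fun x y => 72 • f x y := by
  have h := hf.natCard_div_nsmul_of_cyclic fiveCycle
  rwa [natCard_alternatingGroup_six, orderOf_fiveCycle] at h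

theorem nsmul_cocycle_alternatingGroup_seven {f : _ → _ → Additive kˣ}
    (hf : IsTrivialTwoCocycle (G := alternatingGroup (Fin 7)) f) :
    IsTrivialTwoCoboundary fun x y => 72 • f x y := by
  have h := (hf.natCard_div_nsmul_of_cyclic (alternatingInclusion fiveCycle)).gcd_nsmul
    (hf.natCard_div_nsmul_of_cyclic sevenCycle)
  rwa [natCard_alternatingGroup_seven, orderOf_injective _ alternatingInclusion_injective,
    orderOf_fiveCycle, orderOf_sevenCycle] at h

theorem alternatingInclusion_comp_threeCyclesHom_injective :
    Function.Injective (alternatingInclusion.comp threeCyclesHom) :=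
  alternatingInclusion_injective.comp threeCyclesHom_injective

theorem exists_cocycle_alternatingGroup_seven :
    ∃ F : alternatingGroup (Fin 7) → alternatingGroup (Fin 7) → ZMod 3, IsTrivialTwoCocycle F ∧
      F (alternatingInclusion (threeCyclesHom (gen 1 0)))
          (alternatingInclusion (threeCyclesHom (gen 0 1))) ≠
        F (alternatingInclusion (threeCyclesHom (gen 0 1)))
          (alternatingInclusion (threeCyclesHom (gen 1 0))) :=
  exists_cocycle_of_detForm_invariant alternatingInclusion_comp_threeCyclesHom_injective
    (by
      rw [index_range_of_injective alternatingInclusion_comp_threeCyclesHom_injective,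
        natCard_alternatingGroup_seven]
      decide)
    detForm_eq_one_of_conj

end Final

/-- for `k` algebraically closed of characteristic `2`, the second cohomology
groups `H²(A₆, kˣ)` and `H²(A₇, kˣ)` (coefficients in `kˣ` with trivial action) each have
order `3`, hence are cyclic of order `3`. -/
theorem statement_13 (k : Type) [Field k] [IsAlgClosed k] [CharP k 2] :
    (Nat.card (groupCohomology.H2
        (Rep.trivial ℤ (alternatingGroup (Fin 6)) (Additive kˣ))) = 3 ∧
      IsAddCyclic (groupCohomology.H2
        (Rep.trivial ℤ (alternatingGroup (Fin 6)) (Additive kˣ)))) ∧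
    (Nat.card (groupCohomology.H2
        (Rep.trivial ℤ (alternatingGroup (Fin 7)) (Additive kˣ))) = 3 ∧
      IsAddCyclic (groupCohomology.H2
        (Rep.trivial ℤ (alternatingGroup (Fin 7)) (Additive kˣ)))) := by
  obtain ⟨F, hF, hF'⟩ := exists_cocycle_alternatingGroup_seven
  have h₆ := natCard_H2_units_eq_three (k := k) threeCyclesHom_injective
    (by rw [natCard_alternatingGroup_six]; rfl) (fun _ => nsmul_cocycle_alternatingGroup_six)
    ⟨_, hF.comp_monoidHom alternatingInclusion, hF'⟩
  have h₇ := natCard_H2_units_eq_three (k := k) alternatingInclusion_comp_threeCyclesHom_injective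
    (by rw [natCard_alternatingGroup_seven]; rfl)
    (fun _ => nsmul_cocycle_alternatingGroup_seven) ⟨F, hF, hF'⟩
  exact ⟨⟨h₆, isAddCyclic_of_prime_card h₆⟩, h₇, isAddCyclic_of_prime_card h₇⟩
end

section
/- Let G be a finite group whose Sylow 2-subgroups are dihedral of order 2^n with n ≥ 3. Then G has no strongly 2-embedded subgroup. -/
/-- `S` is a strongly `p`-embedded subgroup of `G`. -/
def StronglyPEmbedded (p : ℕ) {G : Type} [Group G] (S : Subgroup G) : Prop :=
  S ≠ ⊤ ∧ (p ∣ Nat.card S) ∧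
    ∀ x : G, x ∉ S → ¬ p ∣ Nat.card ↥(S ⊓ S.map (MulAut.conj x).toMonoidHom)

section Blocks

variable {A : Type*} [Ring A] [Algebra ℂ A] {n : ℕ} {d : Fin n → ℕ}

/-- The character of the `i`-th matrix block of a split semisimple algebra. -/
def blockChar (e : A ≃ₐ[ℂ] Π i, Matrix (Fin (d i)) (Fin (d i)) ℂ) (i : Fin n) : A →ₗ[ℂ] ℂ :=
  (Matrix.traceLinearMap (Fin (d i)) ℂ ℂ).comp ((LinearMap.proj i).comp e.toLinearMap)

/-- A primitive idempotent in the `i`-th matrix block. -/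
def blockIdem [∀ i, NeZero (d i)] (e : A ≃ₐ[ℂ] Π i, Matrix (Fin (d i)) (Fin (d i)) ℂ)
    (i : Fin n) : A :=
  e.symm (Pi.single i (Matrix.single 0 0 1))

/-- The identity of the `i`-th matrix block. -/
def blockOne (e : A ≃ₐ[ℂ] Π i, Matrix (Fin (d i)) (Fin (d i)) ℂ) (i : Fin n) : A :=
  e.symm (Pi.single i 1)

variable (e : A ≃ₐ[ℂ] Π i, Matrix (Fin (d i)) (Fin (d i)) ℂ)

theorem blockChar_apply (i : Fin n) (a : A) : blockChar e i a = (e a i).trace := rfl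

theorem blockChar_one (i : Fin n) : blockChar e i 1 = d i := by
  simp [blockChar_apply]

theorem blockChar_mul_comm (i : Fin n) (a b : A) :
    blockChar e i (a * b) = blockChar e i (b * a) := by
  rw [blockChar_apply, blockChar_apply, map_mul, map_mul, Pi.mul_apply, Pi.mul_apply,
    Matrix.trace_mul_comm]

theorem exists_nat_trace_of_isIdempotentElem {m : ℕ} {P : Matrix (Fin m) (Fin m) ℂ}
    (hP : IsIdempotentElem P) : ∃ k : ℕ, P.trace = k := by
  have h : IsIdempotentElem (Matrix.toLin' P) := by
    rw [IsIdempotentElem, Module.End.mul_eq_comp, ← Matrix.toLin'_mul, hP.eq]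
  refine ⟨Module.finrank ℂ (LinearMap.range (Matrix.toLin' P)), ?_⟩
  rw [← Matrix.trace_toLin'_eq]
  exact (LinearMap.IsIdempotentElem.isProj_range _ h).trace

theorem exists_nat_blockChar {a : A} (ha : IsIdempotentElem a) (i : Fin n) :
    ∃ k : ℕ, blockChar e i a = k := by
  exact exists_nat_trace_of_isIdempotentElem (P := e a i)
    (by rw [IsIdempotentElem, ← Pi.mul_apply, ← map_mul, ha.eq])

theorem blockChar_blockOne_mul (i j : Fin n) (a : A) :
    blockChar e i (blockOne e j * a) = if i = j then blockChar e i a else 0 := by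
  rw [blockChar_apply, blockOne, map_mul, Pi.mul_apply, AlgEquiv.apply_symm_apply]
  split_ifs with h
  · subst h; simp [blockChar_apply]
  · simp [Pi.single_eq_of_ne h]

theorem exists_smul_of_commute {z : A} (hz : ∀ a, z * a = a * z) (i : Fin n) :
    ∃ c : ℂ, e z i = c • (1 : Matrix (Fin (d i)) (Fin (d i)) ℂ) := by
  have h : ∀ M : Matrix (Fin (d i)) (Fin (d i)) ℂ, Commute M (e z i) := by
    intro M
    have := congrFun (congrArg e (hz (e.symm (Pi.single i M)))) i
    simp only [map_mul, Pi.mul_apply, AlgEquiv.apply_symm_apply, Pi.single_eq_same] at this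
    exact this.symm
  obtain ⟨c, hc⟩ := Matrix.mem_range_scalar_of_commute_single (M := e z i) fun i j _ => h _
  exact ⟨c, by rw [← hc, Matrix.smul_one_eq_diagonal]; rfl⟩

theorem blockChar_mul_blockChar_of_commute {z : A} (hz : ∀ a, z * a = a * z) (i : Fin n) (a : A) :
    blockChar e i z * blockChar e i a = d i * blockChar e i (z * a) := by
  obtain ⟨c, hc⟩ := exists_smul_of_commute e hz i
  simp only [blockChar_apply, map_mul, Pi.mul_apply, hc]
  simp
  ring

theorem mul_blockOne_of_commute [∀ i, NeZero (d i)] {z : A} (hz : ∀ a, z * a = a * z)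
    (i : Fin n) : z * blockOne e i = (blockChar e i z / d i) • blockOne e i := by
  obtain ⟨c, hc⟩ := exists_smul_of_commute e hz i
  have hd : (d i : ℂ) ≠ 0 := Nat.cast_ne_zero.2 (NeZero.ne _)
  have : blockChar e i z / d i = c := by
    rw [blockChar_apply, hc]
    simp [hd]
  rw [this]
  apply e.injective
  funext j
  rw [map_mul, map_smul, blockOne, AlgEquiv.apply_symm_apply, Pi.mul_apply, Pi.smul_apply]
  by_cases h : j = i
  · subst h; simp [hc]
  · simp [Pi.single_eq_of_ne h]

theorem trace_mul_mul_eq_sum_blockChar (a b : A) :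
    LinearMap.trace ℂ A ((LinearMap.mulLeft ℂ a).comp (LinearMap.mulRight ℂ b)) =
      ∑ i, blockChar e i a * blockChar e i b := by
  classical
  let B : Module.Basis (Σ i, Fin (d i) × Fin (d i)) ℂ A :=
    (Pi.basis fun i => Matrix.stdBasis ℂ (Fin (d i)) (Fin (d i))).map e.symm.toLinearEquiv
  rw [LinearMap.trace_eq_matrix_trace ℂ B, Matrix.trace, Fintype.sum_sigma]
  refine Finset.sum_congr rfl fun i _ => ?_
  rw [blockChar_apply, blockChar_apply, Matrix.trace, Matrix.trace, Finset.sum_mul_sum,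
    Fintype.sum_prod_type]
  refine Finset.sum_congr rfl fun j _ => Finset.sum_congr rfl fun k _ => ?_
  rw [Matrix.diag_apply, LinearMap.toMatrix_apply]
  simp only [B, Module.Basis.map_apply, Module.Basis.map_repr, LinearEquiv.trans_apply,
    Pi.basis_repr, Pi.basis_apply, Matrix.stdBasis_eq_single, LinearMap.comp_apply,
    LinearMap.mulLeft_apply, LinearMap.mulRight_apply]
  have h1 (M : Matrix (Fin (d i)) (Fin (d i)) ℂ) (p : Fin (d i) × Fin (d i)) :
      (Matrix.stdBasis ℂ (Fin (d i)) (Fin (d i))).repr M p = M p.1 p.2 := by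
    simp [Matrix.stdBasis]
  rw [h1]
  simp only [AlgEquiv.toLinearEquiv_symm, AlgEquiv.toLinearEquiv_apply, LinearEquiv.symm_symm]
  simp
  rw [Matrix.mul_apply, Finset.sum_eq_single j]
  · simp
  · intro x _ hx
    simp [hx]
  · simp

variable [∀ i, NeZero (d i)]

theorem isIdempotentElem_blockIdem (i : Fin n) : IsIdempotentElem (blockIdem e i) := by
  rw [IsIdempotentElem, blockIdem, ← map_mul, ← Pi.single_mul, Matrix.single_mul_single_same,
    one_mul]

theorem blockChar_blockIdem (i j : Fin n) :
    blockChar e i (blockIdem e j) = if i = j then 1 else 0 := by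
  rw [blockChar_apply, blockIdem, AlgEquiv.apply_symm_apply]
  split_ifs with h
  · subst h; simp
  · simp [Pi.single_eq_of_ne h]

theorem eq_sum_blockChar_of_mul_comm (τ : A →ₗ[ℂ] ℂ) (hτ : ∀ a b, τ (a * b) = τ (b * a)) (a : A) :
    τ a = ∑ i, τ (blockIdem e i) * blockChar e i a := by
  have key : ∀ i (j k : Fin (d i)), τ (e.symm (Pi.single i (Matrix.single j k 1))) =
      if j = k then τ (blockIdem e i) else 0 := by
    intro i j k
    have h1 : e.symm (Pi.single i (Matrix.single j k 1)) =
        e.symm (Pi.single i (Matrix.single j 0 1)) *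
          e.symm (Pi.single i (Matrix.single 0 k 1)) := by
      rw [← map_mul, ← Pi.single_mul, Matrix.single_mul_single_same, one_mul]
    rw [h1, hτ, ← map_mul, ← Pi.single_mul]
    split_ifs with h
    · subst h
      rw [Matrix.single_mul_single_same, one_mul, blockIdem]
    · rw [Matrix.single_mul_single_of_ne _ _ _ _ (Ne.symm h)]
      simp
  have ha : a = ∑ i, ∑ j, ∑ k, e a i j k • e.symm (Pi.single i (Matrix.single j k 1)) := by
    apply e.injective
    simp only [map_sum, map_smul, AlgEquiv.apply_symm_apply]
    funext i
    ext j k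
    simp only [Finset.sum_apply, Pi.smul_apply, Matrix.sum_apply, Matrix.smul_apply]
    rw [Finset.sum_eq_single i]
    · simp only [Pi.single_eq_same]
      conv_lhs => rw [Matrix.matrix_eq_sum_single (e a i)]
      simp [Matrix.sum_apply, Matrix.single_apply]
    · intro b _ hb
      simp [Pi.single_eq_of_ne hb.symm]
    · simp
  conv_lhs => rw [ha]
  simp [key, blockChar_apply, Matrix.trace, Finset.mul_sum, mul_comm]

end Blocks

section GroupAlgebra

open MonoidAlgebra

variable {Γ : Type*} [Group Γ] [Fintype Γ]

theorem exists_blockEquiv (Γ : Type*) [Group Γ] [Finite Γ] :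
    ∃ (n : ℕ) (d : Fin n → ℕ), (∀ i, NeZero (d i)) ∧
      Nonempty (MonoidAlgebra ℂ Γ ≃ₐ[ℂ] Π i, Matrix (Fin (d i)) (Fin (d i)) ℂ) := by
  have : NeZero (Nat.card Γ : ℂ) := ⟨Nat.cast_ne_zero.2 Nat.card_pos.ne'⟩
  have : Module.Finite ℂ (MonoidAlgebra ℂ Γ) := inferInstance
  exact IsSemisimpleRing.exists_algEquiv_pi_matrix_of_isAlgClosed ℂ (MonoidAlgebra ℂ Γ)

theorem MonoidAlgebra.eq_sum_coeff_smul_of (x : MonoidAlgebra ℂ Γ) :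
    x = ∑ g, x.coeff g • of ℂ Γ g := by
  ext h
  simp

theorem MonoidAlgebra.linearMap_ext_of {M : Type*} [AddCommMonoid M] [Module ℂ M]
    {f g : MonoidAlgebra ℂ Γ →ₗ[ℂ] M} (h : ∀ x, f (of ℂ Γ x) = g (of ℂ Γ x)) : f = g := by
  refine LinearMap.ext fun x => ?_
  rw [eq_sum_coeff_smul_of x]
  simp only [map_sum, map_smul, h]

open Classical in
theorem sum_subgroup_eq {M : Type*} [AddCommMonoid M] (K : Subgroup Γ) (F : Γ → M) :
    ∑ k : K, F k = ∑ g, if g ∈ K then F g else 0 := by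
  rw [← Finset.sum_filter]
  exact (Finset.sum_subtype _ (by simp) F).symm

open Classical in
theorem sum_subgroup_eq_zero (K : Subgroup Γ) (F : Γ → ℂ)
    (hF : ∀ k ∈ K, ∀ l ∈ K, F (k * l) = F k * F l) (h : ∃ k ∈ K, F k ≠ 1) :
    ∑ g, (if g ∈ K then F g else 0) = 0 := by
  obtain ⟨k, hk, h1⟩ := h
  have h2 : F k * ∑ g, (if g ∈ K then F g else 0) = ∑ g, (if g ∈ K then F g else 0) := by
    rw [Finset.mul_sum]
    refine Fintype.sum_equiv (Equiv.mulLeft k) _ _ fun g => ?_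
    simp only [Equiv.coe_mulLeft, K.mul_mem_cancel_left hk]
    split_ifs with hg
    · rw [hF k hk g hg]
    · simp
  have h3 : (F k - 1) * ∑ g, (if g ∈ K then F g else 0) = 0 := by rw [sub_mul, h2]; ring
  exact (mul_eq_zero.1 h3).resolve_left (sub_ne_zero.2 h1)

open Classical in
/-- The normalised sum over a subgroup `K` twisted by a function `F`. -/
noncomputable def twistedAvg (K : Subgroup Γ) (F : Γ → ℂ) : MonoidAlgebra ℂ Γ :=
  (Nat.card K : ℂ)⁻¹ • ∑ k : K, F k • of ℂ Γ k

theorem isIdempotentElem_twistedAvg (K : Subgroup Γ) (F : Γ → ℂ)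
    (hF : ∀ k ∈ K, ∀ l ∈ K, F (k * l) = F k * F l) :
    IsIdempotentElem (twistedAvg K F) := by
  classical
  have h0 : (Nat.card K : ℂ) ≠ 0 := Nat.cast_ne_zero.2 Nat.card_pos.ne'
  have h1 : (∑ k : K, F k • of ℂ Γ k) * (∑ k : K, F k • of ℂ Γ k) =
      (Nat.card K : ℂ) • ∑ k : K, F k • of ℂ Γ k := by
    rw [Finset.sum_mul]
    have : ∀ k : K, F k • of ℂ Γ k * ∑ l : K, F l • of ℂ Γ l = ∑ l : K, F l • of ℂ Γ l := by
      intro k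
      rw [Finset.mul_sum]
      refine Fintype.sum_equiv (Equiv.mulLeft k) _ _ fun l => ?_
      rw [smul_mul_smul_comm, ← hF k k.2 l l.2, ← map_mul]
      rfl
    simp_rw [this]
    simp [Nat.card_eq_fintype_card, ← Nat.cast_smul_eq_nsmul ℂ]
  rw [IsIdempotentElem, twistedAvg, smul_mul_smul_comm, h1, smul_smul]
  congr 1
  field_simp

open Classical in
theorem trace_of_mul_mul_of (g h : Γ) :
    LinearMap.trace ℂ (MonoidAlgebra ℂ Γ)
      ((LinearMap.mulLeft ℂ (of ℂ Γ g)).comp (LinearMap.mulRight ℂ (of ℂ Γ h))) =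
      ∑ y : Γ, if y⁻¹ * g⁻¹ * y = h then (1 : ℂ) else 0 := by
  rw [LinearMap.trace_eq_matrix_trace ℂ (MonoidAlgebra.basis Γ ℂ), Matrix.trace]
  refine Finset.sum_congr rfl fun y _ => ?_
  rw [Matrix.diag_apply, LinearMap.toMatrix_apply]
  have h1 : y⁻¹ * g⁻¹ * y = h ↔ g * (y * h) = y :=
    ⟨fun H => by rw [← H]; group, fun H => by
      rw [mul_assoc, inv_mul_eq_iff_eq_mul, inv_mul_eq_iff_eq_mul, H]⟩
  simp only [h1, LinearMap.comp_apply, LinearMap.mulLeft_apply, LinearMap.mulRight_apply]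
  simp [MonoidAlgebra.basis, Finsupp.single_apply]

variable {n : ℕ} {d : Fin n → ℕ}
  (e : MonoidAlgebra ℂ Γ ≃ₐ[ℂ] Π i, Matrix (Fin (d i)) (Fin (d i)) ℂ)

open Classical in
theorem sum_blockChar_of_mul_of (g h : Γ) :
    ∑ i, blockChar e i (of ℂ Γ g) * blockChar e i (of ℂ Γ h) =
      ∑ y : Γ, if y⁻¹ * g⁻¹ * y = h then (1 : ℂ) else 0 := by
  rw [← trace_mul_mul_eq_sum_blockChar, trace_of_mul_mul_of]

theorem sum_dim_mul_blockChar (x : MonoidAlgebra ℂ Γ) :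
    ∑ i, (d i : ℂ) * blockChar e i x = Nat.card Γ * x.coeff 1 := by
  classical
  have h1 (h : Γ) : ∑ i, (d i : ℂ) * blockChar e i (of ℂ Γ h) =
      Nat.card Γ * (of ℂ Γ h).coeff 1 := by
    have := sum_blockChar_of_mul_of e 1 h
    simp only [map_one, blockChar_one] at this
    rw [this]
    simp [Finsupp.single_apply, eq_comm]
  rw [eq_sum_coeff_smul_of x]
  simp only [map_sum, map_smul, Finset.mul_sum, smul_eq_mul]
  rw [Finset.sum_comm]
  simp only [mul_left_comm _ (x.coeff _), ← Finset.mul_sum, h1, coeff_sum, coeff_smul,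
    Finsupp.finsetSum_apply, Finsupp.smul_apply, smul_eq_mul]
  simp only [mul_left_comm (x.coeff _), ← Finset.mul_sum]

theorem sum_blockChar_mul_of_commute {z : MonoidAlgebra ℂ Γ} (hz : ∀ a, z * a = a * z)
    (x : MonoidAlgebra ℂ Γ) :
    ∑ i, blockChar e i z * blockChar e i x = Nat.card Γ * (z * x).coeff 1 := by
  rw [← sum_dim_mul_blockChar e]
  exact Finset.sum_congr rfl fun i _ => blockChar_mul_blockChar_of_commute e hz i x

/-- The augmentation. -/
noncomputable def augmentation (Γ : Type*) [Group Γ] : MonoidAlgebra ℂ Γ →ₐ[ℂ] ℂ :=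
  MonoidAlgebra.lift ℂ ℂ Γ 1

omit [Fintype Γ] in
@[simp]
theorem augmentation_of (g : Γ) : augmentation Γ (of ℂ Γ g) = 1 := by
  simp [augmentation]

omit [Fintype Γ] in
theorem exists_blockChar_eq_augmentation [∀ i, NeZero (d i)] :
    ∃ i, ∀ x, blockChar e i x = augmentation Γ x := by
  have h1 : ∀ i, augmentation Γ (blockIdem e i) = 0 ∨ augmentation Γ (blockIdem e i) = 1 := by
    intro i
    have := (isIdempotentElem_blockIdem e i).map (augmentation Γ)
    exact IsIdempotentElem.iff_eq_zero_or_one.1 this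
  have h2 := eq_sum_blockChar_of_mul_comm e (augmentation Γ).toLinearMap
    (fun a b => by simp [mul_comm])
  simp only [AlgHom.toLinearMap_apply] at h2
  have h3 : ∃ i, augmentation Γ (blockIdem e i) = 1 := by
    by_contra! h
    have := h2 1
    simp [fun i => (h1 i).resolve_right (h i)] at this
  obtain ⟨i, hi⟩ := h3
  refine ⟨i, fun x => ?_⟩
  rw [h2, Finset.sum_eq_single i, hi, one_mul]
  · intro j _ hj
    have h4 : blockIdem e i * blockIdem e j = 0 := by
      rw [blockIdem, blockIdem, ← map_mul]
      convert map_zero e.symm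
      funext k
      by_cases hk : k = i
      · subst hk; simp [Pi.single_eq_of_ne hj.symm]
      · simp [Pi.single_eq_of_ne hk]
    have h5 := congrArg (augmentation Γ) h4
    rw [map_mul, hi, one_mul, map_zero] at h5
    rw [h5, zero_mul]
  · simp

end GroupAlgebra

section Decomposition

theorem exists_three_constituents {n : ℕ} {c : Fin n → ℤ} {d : Fin n → ℕ} (hd : ∀ i, 0 < d i)
    (h3 : ∑ i, c i ^ 2 = 3) {i₀ : Fin n} (hc : c i₀ = 1) (hd₀ : d i₀ = 1)
    (h0 : ∑ i, c i * (d i : ℤ) = 0) :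
    ∃ i₁ i₂, i₀ ≠ i₁ ∧ c i₁ = 1 ∧ d i₂ = d i₁ + 1 ∧
      ∀ f : Fin n → ℂ, ∑ i, (c i : ℂ) * f i = f i₀ + f i₁ - f i₂ := by
  obtain ⟨i₂, hi₂⟩ : ∃ i, c i < 0 := by
    by_contra! h
    have := Finset.single_le_sum (f := fun i => c i * (d i : ℤ))
      (fun i _ => mul_nonneg (h i) (Int.natCast_nonneg _)) (Finset.mem_univ i₀)
    simp [hc, hd₀, h0] at this
  have h02 : i₂ ≠ i₀ := by rintro rfl; omega
  have hm : i₂ ∈ Finset.univ.erase i₀ := by simp [h02]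
  have hs : ∑ i ∈ (Finset.univ.erase i₀).erase i₂, c i ^ 2 = 2 - c i₂ ^ 2 := by
    rw [← Finset.add_sum_erase _ _ (Finset.mem_univ i₀), ← Finset.add_sum_erase _ _ hm, hc] at h3
    linarith
  have hpos : 0 ≤ ∑ i ∈ (Finset.univ.erase i₀).erase i₂, c i ^ 2 :=
    Finset.sum_nonneg fun i _ => sq_nonneg _
  have hc2 : c i₂ = -1 := by nlinarith
  rw [hc2] at hs
  obtain ⟨i₁, hi₁, hne⟩ := Finset.exists_ne_zero_of_sum_ne_zero (by rw [hs]; norm_num :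
    ∑ i ∈ (Finset.univ.erase i₀).erase i₂, c i ^ 2 ≠ 0)
  have hs1 := Finset.add_sum_erase _ (fun i => c i ^ 2) hi₁
  rw [hs] at hs1
  have hpos1 : 0 ≤ ∑ i ∈ ((Finset.univ.erase i₀).erase i₂).erase i₁, c i ^ 2 :=
    Finset.sum_nonneg fun i _ => sq_nonneg _
  have hc1 : 1 ≤ c i₁ ^ 2 := lt_of_le_of_ne (sq_nonneg _) hne.symm
  have hz : ∑ i ∈ ((Finset.univ.erase i₀).erase i₂).erase i₁, c i ^ 2 = 0 := by linarith
  rw [Finset.sum_eq_zero_iff_of_nonneg fun i _ => sq_nonneg _] at hz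
  have hexp : ∀ {R : Type} [CommRing R] (f : Fin n → R),
      ∑ i, (c i : R) * f i = f i₀ + c i₁ * f i₁ - f i₂ := by
    intro R _ f
    rw [← Finset.add_sum_erase _ _ (Finset.mem_univ i₀), ← Finset.add_sum_erase _ _ hm,
      ← Finset.add_sum_erase _ _ hi₁, hc, hc2, Finset.sum_eq_zero]
    · push_cast; ring
    · intro i hi
      rw [pow_eq_zero_iff two_ne_zero |>.1 (hz i hi)]
      simp
  have h0' := hexp fun i => (d i : ℤ)
  simp only [Int.cast_id, h0, hd₀] at h0'
  have hd1 := hd i₁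
  have hd2 := hd i₂
  have hc1' : c i₁ = 1 := by
    have : c i₁ ^ 2 = 1 := by linarith
    rcases (sq_eq_sq_iff_eq_or_eq_neg.1 (this.trans (one_pow 2).symm)) with h | h
    · exact h
    · rw [h] at h0'
      push_cast at h0'
      omega
  refine ⟨i₁, i₂, ?_, hc1', ?_, fun f => by rw [hexp, hc1']; simp⟩
  · rintro rfl; simp at hi₁
  · rw [hc1'] at h0'; push_cast at h0'; omega

end Decomposition

section DihedralData

open MonoidAlgebra

variable {Γ : Type*} [Group Γ]

/-- The local data around a central involution `s` of a dihedral Sylow `2`-subgroup: a subgroup `K`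
of index two in the centralizer of `s`, a reflection `a` outside `K`, and a linear character `L`
of `K` that is inverted by `a`. -/
structure DihedralData (s a : Γ) (K : Subgroup Γ) (L : Γ → ℂ) : Prop where
  s_mul_s : s * s = 1
  s_ne_one : s ≠ 1
  a_mul_a : a * a = 1
  a_notMem : a ∉ K
  s_mem : s ∈ K
  commute_iff : ∀ g, Commute g s ↔ g ∈ K ∨ a * g ∈ K
  map_mul : ∀ k ∈ K, ∀ l ∈ K, L (k * l) = L k * L l
  map_s : L s = -1
  norm_map : ∀ k ∈ K, ‖L k‖ = 1
  conj_mem : ∀ k ∈ K, a * k * a ∈ K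
  map_conj : ∀ k ∈ K, L (a * k * a) = (L k)⁻¹
  s_mem_zpowers : ∀ k ∈ K, L k ≠ 1 → s ∈ Subgroup.zpowers k
  eq_of_mul_self : ∀ k ∈ K, k * k = 1 → k = 1 ∨ k = s
  exists_sq_ne : ∃ k ∈ K, L k ^ 2 ≠ 1

open Classical in
/-- The function `1 - L⁻¹` on `K`, extended by zero. -/
noncomputable def weight (K : Subgroup Γ) (L : Γ → ℂ) (g : Γ) : ℂ :=
  if g ∈ K then 1 - (L g)⁻¹ else 0

variable [Fintype Γ]

/-- The difference of the idempotents of `K` attached to the trivial character and to `L`. -/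
noncomputable def weightElt (K : Subgroup Γ) (L : Γ → ℂ) : MonoidAlgebra ℂ Γ :=
  twistedAvg K (fun _ => 1) - twistedAvg K fun k => (L k)⁻¹

/-- The class function induced from `1 - L` on `K`. -/
noncomputable def inducedFun (K : Subgroup Γ) (L : Γ → ℂ) : MonoidAlgebra ℂ Γ →ₗ[ℂ] ℂ :=
  (MonoidAlgebra.basis Γ ℂ).constr ℂ
    fun g => (Nat.card K : ℂ)⁻¹ * ∑ y, weight K L (y⁻¹ * g⁻¹ * y)

theorem inducedFun_of (K : Subgroup Γ) (L : Γ → ℂ) (g : Γ) :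
    inducedFun K L (of ℂ Γ g) = (Nat.card K : ℂ)⁻¹ * ∑ y, weight K L (y⁻¹ * g⁻¹ * y) := by
  rw [inducedFun, of_apply, ← MonoidAlgebra.basis_apply, Module.Basis.constr_basis]

theorem weightElt_eq (K : Subgroup Γ) (L : Γ → ℂ) :
    weightElt K L = (Nat.card K : ℂ)⁻¹ • ∑ g, weight K L g • of ℂ Γ g := by
  classical
  rw [weightElt, twistedAvg, twistedAvg, ← smul_sub, ← Finset.sum_sub_distrib]
  simp_rw [← sub_smul]
  rw [sum_subgroup_eq K fun k => (1 - (L k)⁻¹) • of ℂ Γ k]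
  congr 1
  refine Finset.sum_congr rfl fun g _ => ?_
  rw [weight]
  split_ifs <;> simp

theorem coeff_weightElt (K : Subgroup Γ) (L : Γ → ℂ) (g : Γ) :
    (weightElt K L).coeff g = (Nat.card K : ℂ)⁻¹ * weight K L g := by
  classical
  rw [weightElt_eq]
  simp [Finsupp.single_apply]

theorem sum_blockChar_weightElt {n : ℕ} {d : Fin n → ℕ}
    (e : MonoidAlgebra ℂ Γ ≃ₐ[ℂ] Π i, Matrix (Fin (d i)) (Fin (d i)) ℂ)
    (K : Subgroup Γ) (L : Γ → ℂ) (x : MonoidAlgebra ℂ Γ) :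
    ∑ i, blockChar e i (weightElt K L) * blockChar e i x = inducedFun K L x := by
  classical
  have h1 (g : Γ) : ∑ i, blockChar e i (weightElt K L) * blockChar e i (of ℂ Γ g) =
      inducedFun K L (of ℂ Γ g) := by
    rw [inducedFun_of, weightElt_eq]
    simp only [map_smul, map_sum, smul_eq_mul, mul_assoc, ← Finset.mul_sum]
    congr 1
    simp only [Finset.sum_mul]
    rw [Finset.sum_comm]
    simp only [mul_assoc, ← Finset.mul_sum]
    simp only [mul_comm (blockChar e _ _) (blockChar e _ (of ℂ Γ g)), sum_blockChar_of_mul_of]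
    simp only [Finset.mul_sum]
    rw [Finset.sum_comm]
    simp [mul_assoc]
  rw [eq_sum_coeff_smul_of x]
  simp only [map_sum, map_smul, Finset.mul_sum, smul_eq_mul]
  rw [Finset.sum_comm]
  simp only [mul_left_comm _ (x.coeff _), ← Finset.mul_sum, h1]

namespace DihedralData

variable {s a : Γ} {K : Subgroup Γ} {L : Γ → ℂ} (h : DihedralData s a K L)

include h

omit [Fintype Γ] in
theorem map_ne_zero {k : Γ} (hk : k ∈ K) : L k ≠ 0 := by
  rw [← norm_ne_zero_iff, h.norm_map k hk]
  exact one_ne_zero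

omit [Fintype Γ] in
theorem map_one : L 1 = 1 := by
  have := h.map_mul 1 K.one_mem 1 K.one_mem
  rw [mul_one] at this
  exact (mul_eq_left₀ (h.map_ne_zero K.one_mem)).1 this.symm

omit [Fintype Γ] in
theorem map_inv {k : Γ} (hk : k ∈ K) : L k⁻¹ = (L k)⁻¹ := by
  have := h.map_mul k hk k⁻¹ (K.inv_mem hk)
  rw [mul_inv_cancel, h.map_one] at this
  exact eq_inv_of_mul_eq_one_right this.symm

omit [Fintype Γ] in
theorem weight_one : weight K L 1 = 0 := by
  simp [weight, K.one_mem, h.map_one]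

omit [Fintype Γ] in
theorem weight_s : weight K L s = 2 := by
  rw [weight, if_pos h.s_mem, h.map_s]
  norm_num

omit [Fintype Γ] in
theorem weight_re_nonneg (g : Γ) : 0 ≤ (weight K L g).re := by
  rw [weight]
  split_ifs with hg
  · have := Complex.re_le_norm (L g)⁻¹
    rw [norm_inv, h.norm_map g hg] at this
    simp only [Complex.sub_re, Complex.one_re]
    linarith
  · simp

omit [Fintype Γ] in
theorem s_mem_zpowers_of_weight {g : Γ} (hg : weight K L g ≠ 0) :
    g ∈ K ∧ s ∈ Subgroup.zpowers g := by
  rw [weight] at hg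
  split_ifs at hg with hk
  · refine ⟨hk, h.s_mem_zpowers g hk fun h1 => hg (by simp [h1])⟩
  · exact absurd rfl hg

omit [Fintype Γ] in
theorem s_inv : s⁻¹ = s := inv_eq_of_mul_eq_one_right h.s_mul_s

omit [Fintype Γ] in
theorem a_inv : a⁻¹ = a := inv_eq_of_mul_eq_one_right h.a_mul_a

omit [Fintype Γ] in
theorem eq_s_of_conj_mem {y : Γ} (hy : y⁻¹ * s * y ∈ K) : Commute y s := by
  rcases h.eq_of_mul_self _ hy (by
    rw [show y⁻¹ * s * y * (y⁻¹ * s * y) = y⁻¹ * (s * s) * y by group,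
      h.s_mul_s]; group) with h1 | h1
  · refine absurd ?_ h.s_ne_one
    have : s = y * (y⁻¹ * s * y) * y⁻¹ := by group
    rw [this, h1]; group
  · rw [mul_assoc, inv_mul_eq_iff_eq_mul] at h1
    exact h1.symm

omit [Fintype Γ] in
/-- The set where `L` is nontrivial is a trivial intersection set. -/
theorem commute_of_weight {g y : Γ} (hg : weight K L g ≠ 0)
    (hy : y⁻¹ * g⁻¹ * y ∈ K) : Commute y s := by
  apply h.eq_s_of_conj_mem
  obtain ⟨m, hm⟩ := Subgroup.mem_zpowers_iff.1 (h.s_mem_zpowers_of_weight hg).2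
  have : y⁻¹ * s * y = (y⁻¹ * g⁻¹ * y) ^ (-m) := by
    have h1 := conj_zpow (a := y⁻¹) (b := g⁻¹) (i := -m)
    rw [inv_inv] at h1
    rw [h1, inv_zpow', neg_neg, hm]
  rw [this]
  exact K.zpow_mem hy _

omit [Fintype Γ] in
theorem a_mul_notMem {g : Γ} (hg : g ∈ K) : a * g ∉ K := fun h1 =>
  h.a_notMem ((K.mul_mem_cancel_right hg).1 h1)

omit [Fintype Γ] in
theorem weight_conj_of_mem {g y : Γ} (hy : y ∈ K) :
    weight K L (y⁻¹ * g * y) = weight K L g := by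
  have hm : y⁻¹ * g * y ∈ K ↔ g ∈ K := by
    rw [K.mul_mem_cancel_right hy, K.mul_mem_cancel_left (K.inv_mem hy)]
  rw [weight, weight]
  by_cases hg : g ∈ K
  · rw [if_pos (hm.2 hg), if_pos hg, h.map_mul _ (K.mul_mem (K.inv_mem hy) hg) _ hy,
      h.map_mul _ (K.inv_mem hy) _ hg, h.map_inv hy]
    have := h.map_ne_zero hy
    congr 2
    field_simp
  · rw [if_neg (fun H => hg (hm.1 H)), if_neg hg]

omit [Fintype Γ] in
theorem weight_conj_a (g : Γ) : weight K L (a * g * a) = weight K L g⁻¹ := by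
  have hm : a * g * a ∈ K ↔ g ∈ K := by
    refine ⟨fun H => ?_, h.conj_mem g⟩
    have := h.conj_mem _ H
    rwa [show a * (a * g * a) * a = (a * a) * g * (a * a) by group, h.a_mul_a, one_mul,
      mul_one] at this
  rw [weight, weight]
  by_cases hg : g ∈ K
  · rw [if_pos (hm.2 hg), if_pos (K.inv_mem hg), h.map_conj g hg, h.map_inv hg]
  · rw [if_neg (fun H => hg (hm.1 H)), if_neg (fun H => hg (by simpa using H))]

omit [Fintype Γ] in
theorem weight_conj_of_a_mul_mem {g y : Γ} (hy : a * y ∈ K) :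
    weight K L (y⁻¹ * g * y) = weight K L g⁻¹ := by
  have h1 := h.weight_conj_of_mem (g := a * g * a) hy
  rw [h.weight_conj_a] at h1
  rw [← h1]
  congr 1
  rw [mul_inv_rev, h.a_inv]
  calc y⁻¹ * g * y = y⁻¹ * 1 * g * 1 * y := by group
    _ = _ := by rw [← h.a_mul_a]; group

open Classical in
theorem sum_ite_mem (z w : ℂ) :
    ∑ y : Γ, (if y ∈ K then z else if a * y ∈ K then w else 0) = Nat.card K * (z + w) := by
  have h1 (z : ℂ) : ∑ y : Γ, (if y ∈ K then z else 0) = Nat.card K * z := by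
    rw [← sum_subgroup_eq K fun _ => z]
    simp
  have h2 : ∑ y : Γ, (if a * y ∈ K then w else 0) = Nat.card K * w := by
    rw [← h1 w]
    exact Fintype.sum_equiv (Equiv.mulLeft a) _ _ fun g => rfl
  rw [mul_add, ← h1 z, ← h2, ← Finset.sum_add_distrib]
  refine Finset.sum_congr rfl fun y _ => ?_
  by_cases hy : y ∈ K
  · simp [hy, h.a_mul_notMem hy]
  · simp [hy]

omit h in
theorem card_ne_zero : (Nat.card K : ℂ) ≠ 0 := Nat.cast_ne_zero.2 Nat.card_pos.ne'

theorem inducedFun_one : inducedFun K L 1 = 0 := by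
  rw [← MonoidHom.map_one (of ℂ Γ), inducedFun_of]
  simp [h.weight_one]

theorem inducedFun_s : inducedFun K L (of ℂ Γ s) = 4 := by
  classical
  have h1 (y : Γ) : weight K L (y⁻¹ * s⁻¹ * y) =
      if y ∈ K then 2 else if a * y ∈ K then 2 else 0 := by
    rw [h.s_inv]
    by_cases hy : Commute y s
    · have h2 : y⁻¹ * s * y = s := by rw [mul_assoc, inv_mul_eq_iff_eq_mul]; exact hy.symm
      rw [h2, h.weight_s]
      rcases (h.commute_iff y).1 hy with h3 | h3 <;> simp [h3]
    · have h3 := mt (h.commute_iff y).2 hy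
      push Not at h3
      rw [weight, if_neg (fun H => hy (h.eq_s_of_conj_mem H)), if_neg h3.1, if_neg h3.2]
  rw [inducedFun_of]
  simp_rw [h1]
  rw [h.sum_ite_mem]
  have := card_ne_zero (K := K)
  field_simp
  norm_num

omit [Fintype Γ] in
theorem weight_mul_weight_conj (g y : Γ) [Decidable (y ∈ K)] [Decidable (a * y ∈ K)] :
    weight K L g * weight K L (y⁻¹ * g⁻¹ * y) =
      if y ∈ K then weight K L g * weight K L g⁻¹ else
        if a * y ∈ K then weight K L g * weight K L g else 0 := by
  split_ifs with h1 h2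
  · rw [h.weight_conj_of_mem h1]
  · rw [h.weight_conj_of_a_mul_mem h2, inv_inv]
  · by_cases h3 : weight K L g = 0
    · rw [h3, zero_mul]
    by_cases h4 : weight K L (y⁻¹ * g⁻¹ * y) = 0
    · rw [h4, mul_zero]
    have := h.commute_of_weight h3 (h.s_mem_zpowers_of_weight h4).1
    exact absurd ((h.commute_iff y).1 this) (by tauto)

open Classical in
theorem sum_inv_eq_zero : ∑ k : K, (L k)⁻¹ = 0 := by
  classical
  obtain ⟨k, hk, hk2⟩ := h.exists_sq_ne
  rw [sum_subgroup_eq K fun k => (L k)⁻¹]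
  refine sum_subgroup_eq_zero K _ (fun k hk l hl => by rw [h.map_mul k hk l hl, mul_inv])
    ⟨k, hk, fun H => hk2 ?_⟩
  rw [inv_eq_one.1 H, one_pow]

open Classical in
theorem sum_eq_zero : ∑ k : K, L k = 0 := by
  classical
  obtain ⟨k, hk, hk2⟩ := h.exists_sq_ne
  rw [sum_subgroup_eq K fun k => L k]
  refine sum_subgroup_eq_zero K _ h.map_mul ⟨k, hk, fun H => hk2 ?_⟩
  rw [H, one_pow]

open Classical in
theorem sum_inv_sq_eq_zero : ∑ k : K, (L k)⁻¹ ^ 2 = 0 := by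
  classical
  obtain ⟨k, hk, hk2⟩ := h.exists_sq_ne
  rw [sum_subgroup_eq K fun k => (L k)⁻¹ ^ 2]
  refine sum_subgroup_eq_zero K _
    (fun k hk l hl => by rw [h.map_mul k hk l hl, mul_inv, mul_pow])
    ⟨k, hk, fun H => hk2 ?_⟩
  rwa [inv_pow, inv_eq_one] at H

theorem sum_weight : ∑ g, weight K L g = Nat.card K := by
  classical
  simp only [weight]
  rw [← sum_subgroup_eq K fun g => 1 - (L g)⁻¹, Finset.sum_sub_distrib, h.sum_inv_eq_zero]
  simp

theorem inducedFun_weightElt : inducedFun K L (weightElt K L) = 3 := by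
  classical
  have h0 := card_ne_zero (K := K)
  have h1 (g : Γ) : weight K L g * ∑ y, weight K L (y⁻¹ * g⁻¹ * y) = Nat.card K *
      if g ∈ K then 3 - L g - 3 * (L g)⁻¹ + (L g)⁻¹ ^ 2 else 0 := by
    rw [Finset.mul_sum]
    simp_rw [h.weight_mul_weight_conj g]
    rw [h.sum_ite_mem]
    congr 1
    by_cases hg : g ∈ K
    · simp only [weight, hg, K.inv_mem hg, if_true, h.map_inv hg, inv_inv]
      have := h.map_ne_zero hg
      field_simp
      ring
    · simp [weight, hg]
  rw [weightElt_eq]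
  simp only [map_smul, map_sum, smul_eq_mul, inducedFun_of, mul_left_comm (weight K L _)]
  rw [← Finset.mul_sum]
  simp_rw [h1]
  rw [← Finset.mul_sum, ← sum_subgroup_eq K fun g => 3 - L g - 3 * (L g)⁻¹ + (L g)⁻¹ ^ 2]
  rw [Finset.sum_add_distrib, Finset.sum_sub_distrib, Finset.sum_sub_distrib, ← Finset.mul_sum,
    h.sum_inv_sq_eq_zero, h.sum_inv_eq_zero, h.sum_eq_zero]
  simp only [Finset.sum_const, Finset.card_univ, nsmul_eq_mul, ← Nat.card_eq_fintype_card]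
  field_simp
  ring

variable {n : ℕ} {d : Fin n → ℕ}
  (e : MonoidAlgebra ℂ Γ ≃ₐ[ℂ] Π i, Matrix (Fin (d i)) (Fin (d i)) ℂ)

theorem exists_int_blockChar_weightElt (i : Fin n) :
    ∃ c : ℤ, blockChar e i (weightElt K L) = c := by
  obtain ⟨k, hk⟩ := exists_nat_blockChar e
    (isIdempotentElem_twistedAvg K (fun _ => 1) fun _ _ _ _ => (one_mul 1).symm) i
  obtain ⟨l, hl⟩ := exists_nat_blockChar e
    (isIdempotentElem_twistedAvg K (fun k => (L k)⁻¹)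
      fun k hk l hl => by rw [h.map_mul k hk l hl, mul_inv]) i
  exact ⟨k - l, by rw [weightElt, map_sub, hk, hl]; push_cast; rfl⟩

theorem augmentation_weightElt : augmentation Γ (weightElt K L) = 1 := by
  rw [weightElt_eq]
  simp only [map_smul, map_sum, augmentation_of, smul_eq_mul, mul_one, h.sum_weight]
  exact inv_mul_cancel₀ (card_ne_zero (K := K))

/-- The induced class function is a sum `1 + χ₁ - χ₂` with irreducible characters `χ₁`, `χ₂`. -/
theorem exists_constituents [∀ i, NeZero (d i)] :
    ∃ i₀ i₁ i₂, i₀ ≠ i₁ ∧ (∀ x, blockChar e i₀ x = augmentation Γ x) ∧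
      blockChar e i₁ (weightElt K L) = 1 ∧ d i₂ = d i₁ + 1 ∧
      blockChar e i₂ (of ℂ Γ s) = blockChar e i₁ (of ℂ Γ s) - 3 ∧
      ∀ f : Fin n → ℂ, ∑ i, blockChar e i (weightElt K L) * f i = f i₀ + f i₁ - f i₂ := by
  obtain ⟨i₀, hi₀⟩ := exists_blockChar_eq_augmentation e
  choose c hc using h.exists_int_blockChar_weightElt e
  have hc0 : c i₀ = 1 := by
    have := hc i₀
    rw [hi₀, h.augmentation_weightElt] at this
    exact_mod_cast this.symm
  have hd0 : d i₀ = 1 := by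
    have := hi₀ 1
    rw [blockChar_one, _root_.map_one] at this
    exact_mod_cast this
  have h3 : ∑ i, c i ^ 2 = 3 := by
    have := sum_blockChar_weightElt e K L (weightElt K L)
    rw [h.inducedFun_weightElt] at this
    simp only [hc, ← sq] at this
    exact_mod_cast this
  have h0 : ∑ i, c i * (d i : ℤ) = 0 := by
    have := sum_blockChar_weightElt e K L 1
    rw [h.inducedFun_one] at this
    simp only [hc, blockChar_one] at this
    exact_mod_cast this
  obtain ⟨i₁, i₂, h01, hc1, hd, hf⟩ :=
    exists_three_constituents (fun i => Nat.pos_of_ne_zero (NeZero.ne (d i))) h3 hc0 hd0 h0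
  refine ⟨i₀, i₁, i₂, h01, hi₀, by rw [hc, hc1]; simp, hd, ?_, by simpa only [hc] using hf⟩
  have hs := sum_blockChar_weightElt e K L (of ℂ Γ s)
  simp only [hc] at hs
  rw [h.inducedFun_s, hf, hi₀, augmentation_of] at hs
  linear_combination -hs

end DihedralData

end DihedralData

section ConjSum

open MonoidAlgebra

variable {Γ : Type*} [Group Γ] [Fintype Γ]

/-- The sum of all conjugates of `s`, counted with multiplicity. -/
noncomputable def conjSum (s : Γ) : MonoidAlgebra ℂ Γ := ∑ y, of ℂ Γ (y * s * y⁻¹)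

theorem conjSum_mul_comm (s : Γ) (x : MonoidAlgebra ℂ Γ) : conjSum s * x = x * conjSum s := by
  have h1 : LinearMap.mulLeft ℂ (conjSum s) = LinearMap.mulRight ℂ (conjSum s) := by
    refine linearMap_ext_of fun g => ?_
    rw [LinearMap.mulLeft_apply, LinearMap.mulRight_apply, conjSum, Finset.sum_mul, Finset.mul_sum]
    refine Fintype.sum_equiv (Equiv.mulLeft g⁻¹) _ _ fun y => ?_
    rw [← map_mul, ← map_mul, Equiv.coe_mulLeft]
    congr 1
    group
  exact LinearMap.congr_fun h1 x

variable {n : ℕ} {d : Fin n → ℕ}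
  (e : MonoidAlgebra ℂ Γ ≃ₐ[ℂ] Π i, Matrix (Fin (d i)) (Fin (d i)) ℂ)

theorem blockChar_conjSum (s : Γ) (i : Fin n) :
    blockChar e i (conjSum s) = Nat.card Γ * blockChar e i (of ℂ Γ s) := by
  have h1 (y : Γ) : blockChar e i (of ℂ Γ (y * s * y⁻¹)) = blockChar e i (of ℂ Γ s) := by
    rw [map_mul, blockChar_mul_comm, ← map_mul]
    congr 2
    group
  rw [conjSum, map_sum, Finset.sum_congr rfl fun y _ => h1 y]
  simp

theorem sum_mul_eq_augmentation_smul (x : MonoidAlgebra ℂ Γ) :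
    (∑ g, of ℂ Γ g) * x = augmentation Γ x • ∑ g, of ℂ Γ g := by
  have h1 : LinearMap.mulLeft ℂ (∑ g, of ℂ Γ g) =
      (augmentation Γ).toLinearMap.smulRight (∑ g, of ℂ Γ g) := by
    refine linearMap_ext_of fun g => ?_
    rw [LinearMap.mulLeft_apply, LinearMap.smulRight_apply, AlgHom.toLinearMap_apply,
      augmentation_of, one_smul, Finset.sum_mul]
    exact Fintype.sum_equiv (Equiv.mulRight g) _ _ fun y => by simp
  exact LinearMap.congr_fun h1 x

omit [Fintype Γ] in
theorem isIdempotentElem_half_add {s : Γ} (hs : s * s = 1) (c : ℂ) (hc : c * c = 1) :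
    IsIdempotentElem ((1 / 2 : ℂ) • (1 + c • of ℂ Γ s)) := by
  have h1 : of ℂ Γ s * of ℂ Γ s = 1 := by rw [← map_mul, hs, map_one]
  have h2 : (1 + c • of ℂ Γ s) * (1 + c • of ℂ Γ s) = (2 : ℂ) • (1 + c • of ℂ Γ s) := by
    rw [add_mul, mul_add, mul_add, smul_mul_smul_comm, h1, hc, two_smul]
    simp only [one_mul, mul_one, one_smul]
    abel
  rw [IsIdempotentElem, smul_mul_smul_comm, h2, smul_smul]
  norm_num

namespace DihedralData

variable {s a : Γ} {K : Subgroup Γ} {L : Γ → ℂ} (h : DihedralData s a K L)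

include h

open Classical in
theorem weight_centralizer_sum {C : Subgroup Γ} (hC : ∀ g, g ∈ C ↔ Commute g s) {y : Γ}
    (hy : y ∈ C) :
    ∑ g, (if g ∈ C then weight K L (y⁻¹ * g⁻¹ * y) else 0) = Nat.card K := by
  rw [← h.sum_weight]
  refine Fintype.sum_equiv ((Equiv.inv Γ).trans ((MulAut.conj y⁻¹).toEquiv)) _ _ fun g => ?_
  have h1 : ((Equiv.inv Γ).trans ((MulAut.conj y⁻¹).toEquiv)) g = y⁻¹ * g⁻¹ * y := by simp
  rw [h1]
  split_ifs with hg
  · rfl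
  · rw [weight, if_neg]
    intro H
    apply hg
    have h2 : y⁻¹ * g⁻¹ * y ∈ C := (hC _).2 ((h.commute_iff _).2 (Or.inl H))
    rw [C.mul_mem_cancel_right hy, C.mul_mem_cancel_left (C.inv_mem hy)] at h2
    exact C.inv_mem_iff.1 h2

theorem one_lt_re_inducedFun {C : Subgroup Γ} (hC : ∀ g, g ∈ C ↔ Commute g s)
    {y₀ : Γ} (hy₀ : y₀ * s * y₀⁻¹ = a) (has : Commute a s) :
    1 < (inducedFun K L (twistedAvg C fun _ => 1)).re := by
  classical
  have hCpos : (0 : ℝ) < Nat.card C := Nat.cast_pos.2 Nat.card_pos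
  have hKpos : (0 : ℝ) < Nat.card K := Nat.cast_pos.2 Nat.card_pos
  set F : Γ → ℝ := fun y => ∑ g, (if g ∈ C then (weight K L (y⁻¹ * g⁻¹ * y)).re else 0) with hF
  have hF0 (y : Γ) (g : Γ) : 0 ≤ (if g ∈ C then (weight K L (y⁻¹ * g⁻¹ * y)).re else 0) := by
    split_ifs
    · exact h.weight_re_nonneg _
    · exact le_rfl
  have hy₀C : y₀ ∉ C := by
    intro H
    have h1 : y₀ * s = s * y₀ := (hC _).1 H
    rw [h1, mul_assoc, mul_inv_cancel, mul_one] at hy₀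
    exact h.a_notMem (hy₀ ▸ h.s_mem)
  have h1 (y : Γ) : (if y ∈ C then (Nat.card K : ℝ) else 0) + (if y = y₀ then 2 else 0) ≤ F y := by
    by_cases hy : y ∈ C
    · have h2 : F y = Nat.card K := by
        have := congrArg Complex.re (h.weight_centralizer_sum hC hy)
        rw [Complex.re_sum, Complex.natCast_re] at this
        rw [← this]
        refine Finset.sum_congr rfl fun g _ => ?_
        split_ifs <;> simp
      rw [if_pos hy, if_neg (by rintro rfl; exact hy₀C hy), h2, add_zero]
    · rw [if_neg hy, zero_add]
      split_ifs with h2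
      · subst h2
        refine le_trans ?_ (Finset.single_le_sum (fun g _ => hF0 y g) (Finset.mem_univ a))
        have h3 : y⁻¹ * a⁻¹ * y = s := by rw [h.a_inv, ← hy₀]; group
        rw [if_pos ((hC a).2 has), h3, h.weight_s]
        norm_num
      · exact Finset.sum_nonneg fun g _ => hF0 y g
  have h2 : (Nat.card C : ℝ) * Nat.card K + 2 ≤ ∑ y, F y := by
    refine le_trans (le_of_eq ?_) (Finset.sum_le_sum fun y _ => h1 y)
    rw [Finset.sum_add_distrib, ← sum_subgroup_eq C fun _ => (Nat.card K : ℝ)]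
    simp
  have h3 : inducedFun K L (twistedAvg C fun _ => 1) = ((Nat.card C : ℝ)⁻¹ : ℝ) *
      (((Nat.card K : ℝ)⁻¹ : ℝ) * ∑ y, ∑ g, if g ∈ C then weight K L (y⁻¹ * g⁻¹ * y) else 0) := by
    rw [twistedAvg, map_smul, map_sum, Finset.sum_comm, smul_eq_mul]
    simp only [one_smul, inducedFun_of]
    rw [← Finset.mul_sum, sum_subgroup_eq C fun g => ∑ y, weight K L (y⁻¹ * g⁻¹ * y)]
    push_cast
    congr 1
    congr 1
    refine Finset.sum_congr rfl fun g _ => ?_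
    split_ifs <;> simp
  rw [h3, Complex.re_ofReal_mul, Complex.re_ofReal_mul, Complex.re_sum]
  have h4 : ∑ y, (∑ g, if g ∈ C then weight K L (y⁻¹ * g⁻¹ * y) else 0).re = ∑ y, F y := by
    refine Finset.sum_congr rfl fun y _ => ?_
    rw [Complex.re_sum]
    refine Finset.sum_congr rfl fun g _ => ?_
    split_ifs <;> simp
  rw [h4, ← mul_assoc, ← mul_inv, inv_mul_eq_div, lt_div_iff₀ (by positivity)]
  linarith

omit h in
theorem coeff_conjSum_mul_weightElt :
    (conjSum s * conjSum s * weightElt K L).coeff 1 =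
      (Nat.card K : ℂ)⁻¹ * ∑ y, ∑ z, weight K L ((y * s * y⁻¹ * (z * s * z⁻¹))⁻¹) := by
  classical
  simp only [conjSum, Finset.sum_mul, Finset.mul_sum, coeff_sum, Finsupp.finsetSum_apply]
  rw [Finset.sum_comm]
  refine Finset.sum_congr rfl fun y _ => Finset.sum_congr rfl fun z _ => ?_
  rw [← _root_.map_mul, of_apply, coeff_single_mul_apply, coeff_weightElt]
  simp

theorem sum_weight_re_pos {y z : Γ} (hy : y * s * y⁻¹ = a) (hz : z * s * z⁻¹ = a * s) :
    0 < (∑ y, ∑ z, weight K L ((y * s * y⁻¹ * (z * s * z⁻¹))⁻¹)).re := by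
  simp only [Complex.re_sum]
  have h1 : 0 < (weight K L ((y * s * y⁻¹ * (z * s * z⁻¹))⁻¹)).re := by
    rw [hy, hz, ← mul_assoc, h.a_mul_a, one_mul, h.s_inv, h.weight_s]
    norm_num
  refine Finset.sum_pos' (fun y _ => Finset.sum_nonneg fun z _ => h.weight_re_nonneg _)
    ⟨y, Finset.mem_univ _, Finset.sum_pos' (fun z _ => h.weight_re_nonneg _)
      ⟨z, Finset.mem_univ _, h1⟩⟩

omit h in
theorem sum_blockChar_conjSum_sq [∀ i, NeZero (d i)] :
    (Nat.card Γ : ℂ) * ∑ i, blockChar e i (weightElt K L) *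
      (blockChar e i (of ℂ Γ s) ^ 2 / d i) =
      (Nat.card K : ℂ)⁻¹ * ∑ y, ∑ z, weight K L ((y * s * y⁻¹ * (z * s * z⁻¹))⁻¹) := by
  have hΓ : (Nat.card Γ : ℂ) ≠ 0 := Nat.cast_ne_zero.2 Nat.card_pos.ne'
  have h1 := sum_blockChar_mul_of_commute e (z := conjSum s * conjSum s)
    (fun x => by rw [mul_assoc, conjSum_mul_comm s x, ← mul_assoc, conjSum_mul_comm s x, mul_assoc])
    (weightElt K L)
  rw [coeff_conjSum_mul_weightElt] at h1
  apply mul_left_cancel₀ hΓ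
  rw [← h1, Finset.mul_sum, Finset.mul_sum]
  refine Finset.sum_congr rfl fun i _ => ?_
  have h2 := blockChar_mul_blockChar_of_commute e (conjSum_mul_comm s) i (conjSum s)
  rw [blockChar_conjSum] at h2
  have hd : (d i : ℂ) ≠ 0 := Nat.cast_ne_zero.2 (NeZero.ne _)
  field_simp
  linear_combination blockChar e i (weightElt K L) * h2

end DihedralData

end ConjSum

section Restriction

open MonoidAlgebra

variable {G : Type*} [Group G] {H : Subgroup G} {s a : G} {K : Subgroup G} {L : G → ℂ}

/-- The inclusion of the group algebra of a subgroup. -/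
noncomputable def subgroupIncl (H : Subgroup G) : MonoidAlgebra ℂ H →ₐ[ℂ] MonoidAlgebra ℂ G :=
  mapDomainAlgHom ℂ ℂ H.subtype

@[simp]
theorem subgroupIncl_of (x : H) : subgroupIncl H (of ℂ H x) = of ℂ G x := by
  simp [subgroupIncl]

namespace DihedralData

theorem subgroupOf (h : DihedralData s a K L) (hs : s ∈ H) (ha : a ∈ H) (hK : K ≤ H) :
    DihedralData (⟨s, hs⟩ : H) ⟨a, ha⟩ (K.subgroupOf H) fun x => L x where
  s_mul_s := Subtype.ext h.s_mul_s
  s_ne_one H := h.s_ne_one (congrArg Subtype.val H)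
  a_mul_a := Subtype.ext h.a_mul_a
  a_notMem := h.a_notMem
  s_mem := h.s_mem
  commute_iff g := by
    have : Commute g ⟨s, hs⟩ ↔ Commute (g : G) s := by
      simp [Commute, SemiconjBy, Subtype.ext_iff]
    rw [this, h.commute_iff]
    rfl
  map_mul k hk l hl := h.map_mul k hk l hl
  map_s := h.map_s
  norm_map k hk := h.norm_map k hk
  conj_mem k hk := h.conj_mem k hk
  map_conj k hk := h.map_conj k hk
  s_mem_zpowers k hk hL := by
    obtain ⟨m, hm⟩ := Subgroup.mem_zpowers_iff.1 (h.s_mem_zpowers k hk hL)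
    exact Subgroup.mem_zpowers_iff.2 ⟨m, Subtype.ext hm⟩
  eq_of_mul_self k hk hkk := by
    rcases h.eq_of_mul_self k hk (congrArg Subtype.val hkk) with h1 | h1
    · exact Or.inl (Subtype.ext h1)
    · exact Or.inr (Subtype.ext h1)
  exists_sq_ne := by
    obtain ⟨k, hk, h2⟩ := h.exists_sq_ne
    exact ⟨⟨k, hK hk⟩, hk, h2⟩

variable [Fintype G] [Fintype H] (h : DihedralData s a K L) 

open Classical in
theorem _root_.sum_eq_sum_subgroup {M : Type*} [AddCommMonoid M] (F : G → M)
    (hF : ∀ y ∉ H, F y = 0) : ∑ y, F y = ∑ y : H, F y := by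
  have := sum_subgroup_eq H F
  convert this.symm using 1
  · refine Finset.sum_congr rfl fun y _ => ?_
    split_ifs with hy
    · rfl
    · exact hF y hy
  · congr!

include h

theorem inducedFun_subgroupIncl (hE : ∀ g, g * s * g⁻¹ ∈ H → g ∈ H) (hK : K ≤ H)
    (x : MonoidAlgebra ℂ H) :
    inducedFun K L (subgroupIncl H x) = inducedFun (K.subgroupOf H) (fun x => L x) x := by
  suffices (inducedFun K L).comp (subgroupIncl H).toLinearMap =
    inducedFun (K.subgroupOf H) (fun x => L x) from LinearMap.congr_fun this x
  refine linearMap_ext_of fun g => ?_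
  rw [LinearMap.comp_apply, AlgHom.toLinearMap_apply, subgroupIncl_of, inducedFun_of,
    inducedFun_of, Nat.card_congr (Subgroup.subgroupOfEquivOfLe hK).toEquiv]
  congr 1
  refine sum_eq_sum_subgroup _ fun y hy => ?_
  by_contra hw
  apply hy
  apply hE
  obtain ⟨m, hm⟩ := Subgroup.mem_zpowers_iff.1 (h.s_mem_zpowers_of_weight hw).2
  have h1 := conj_zpow (a := y⁻¹) (b := (g : G)⁻¹) (i := m)
  rw [inv_inv, hm] at h1
  rw [h1]
  have : y * (y⁻¹ * (g : G)⁻¹ ^ m * y) * y⁻¹ = (g : G)⁻¹ ^ m := by group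
  rw [this]
  exact H.zpow_mem (H.inv_mem g.2) m

theorem sum_weight_eq_sum_subgroup (hs : s ∈ H) (hE : ∀ g, g * s * g⁻¹ ∈ H → g ∈ H)
    (hC : ∀ g, Commute g s → g ∈ H) :
    ∑ y, ∑ z, weight K L ((y * s * y⁻¹ * (z * s * z⁻¹))⁻¹) =
      ∑ y : H, ∑ z : H, weight (K.subgroupOf H) (fun x => L x)
        ((y * ⟨s, hs⟩ * y⁻¹ * (z * ⟨s, hs⟩ * z⁻¹))⁻¹) := by
  have key (y z : G) (hw : weight K L ((y * s * y⁻¹ * (z * s * z⁻¹))⁻¹) ≠ 0) : y ∈ H ∧ z ∈ H := by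
    obtain ⟨hk, hz⟩ := h.s_mem_zpowers_of_weight hw
    set u := y * s * y⁻¹ with hu
    set v := z * s * z⁻¹ with hv
    have huu : u * u = 1 := by
      rw [hu, show y * s * y⁻¹ * (y * s * y⁻¹) = y * (s * s) * y⁻¹ by group, h.s_mul_s]; group
    have hvv : v * v = 1 := by
      rw [hv, show z * s * z⁻¹ * (z * s * z⁻¹) = z * (s * s) * z⁻¹ by group, h.s_mul_s]; group
    clear_value u v
    have hui : u⁻¹ = u := inv_eq_of_mul_eq_one_right huu
    have hvi : v⁻¹ = v := inv_eq_of_mul_eq_one_right hvv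
    obtain ⟨m, hm⟩ := Subgroup.mem_zpowers_iff.1 hz
    have h1 : u * s * u⁻¹ = s := by
      have h2 := conj_zpow (a := u) (b := (u * v)⁻¹) (i := m)
      rw [hm] at h2
      rw [← h2]
      have h3 : u * (u * v)⁻¹ * u⁻¹ = ((u * v)⁻¹)⁻¹ := by
        rw [inv_inv, mul_inv_rev, hvi, hui, mul_assoc, mul_assoc, huu, mul_one]
      rw [h3, inv_zpow, hm, h.s_inv]
    have h4 : Commute u s := mul_inv_eq_iff_eq_mul.1 h1
    have huH : u ∈ H := hC u h4
    have huvH : (u * v)⁻¹ ∈ H := hC _ ((h.commute_iff _).2 (Or.inl hk))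
    rw [H.inv_mem_iff, H.mul_mem_cancel_left huH] at huvH
    exact ⟨hE y (hu ▸ huH), hE z (hv ▸ huvH)⟩
  rw [sum_eq_sum_subgroup (H := H)]
  · refine Finset.sum_congr rfl fun y _ => ?_
    rw [sum_eq_sum_subgroup (H := H)]
    · rfl
    · intro z hz
      by_contra hw
      exact hz (key y z hw).2
  · intro y hy
    refine Finset.sum_eq_zero fun z _ => ?_
    by_contra hw
    exact hy (key y z hw).1

open Classical in
omit h in
theorem sum_centralizer_eq (hs : s ∈ H) (hC : ∀ g, Commute g s → g ∈ H)
    {C : Subgroup H} (hCm : ∀ g, g ∈ C ↔ Commute g ⟨s, hs⟩) {M : Type*} [AddCommMonoid M]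
    (f : G → M) : ∑ c : C, f c = ∑ c, if Commute c s then f c else 0 := by
  rw [sum_subgroup_eq C fun c : H => f c, sum_eq_sum_subgroup (H := H)]
  · refine Finset.sum_congr rfl fun c _ => ?_
    have : c ∈ C ↔ Commute (c : G) s := by
      rw [hCm]
      simp [Commute, SemiconjBy, Subtype.ext_iff]
    simp only [this]
  · intro c hc
    rw [if_neg fun H => hc (hC c H)]

omit h in
theorem conjSum_mul_centralizerAvg (hs : s ∈ H) (hC : ∀ g, Commute g s → g ∈ H)
    (hE : ∀ g, g * s * g⁻¹ ∈ H → g ∈ H) 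
    (hcos : ∀ g ∉ H, ∃ y₀, ∀ y, Commute (g⁻¹ * (y * s * y⁻¹)) s ↔ Commute (y₀⁻¹ * y) s)
    {C : Subgroup H} (hCm : ∀ g, g ∈ C ↔ Commute g ⟨s, hs⟩) :
    conjSum s * subgroupIncl H (twistedAvg C fun _ => 1) =
      subgroupIncl H (conjSum ⟨s, hs⟩ * twistedAvg C fun _ => 1) +
        (∑ g, of ℂ G g - subgroupIncl H (∑ g, of ℂ H g)) := by
  classical
  have hcard : (Nat.card C : ℂ) = ∑ c : G, if Commute c s then (1 : ℂ) else 0 := by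
    rw [← sum_centralizer_eq hs hC hCm fun _ => (1 : ℂ)]
    simp
  have h0 : (Nat.card C : ℂ) ≠ 0 := Nat.cast_ne_zero.2 Nat.card_pos.ne'
  set F : G → MonoidAlgebra ℂ G := fun y =>
    ∑ g, if Commute (g⁻¹ * (y * s * y⁻¹)) s then of ℂ G g else 0 with hF
  have hF1 (y : G) : of ℂ G (y * s * y⁻¹) * ∑ c : C, of ℂ G c = F y := by
    rw [sum_centralizer_eq hs hC hCm fun c => of ℂ G c, Finset.mul_sum]
    refine Fintype.sum_equiv (Equiv.mulLeft (y * s * y⁻¹)) _ _ fun c => ?_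
    have h1 : Commute ((y * s * y⁻¹ * c)⁻¹ * (y * s * y⁻¹)) s ↔ Commute c s := by
      rw [show (y * s * y⁻¹ * c)⁻¹ * (y * s * y⁻¹) = c⁻¹ by group, Commute.inv_left_iff]
    simp only [Equiv.coe_mulLeft, h1, mul_ite, mul_zero, ← _root_.map_mul]
  have hF2 : ∑ y, F y = ∑ y : H, F y + ∑ y, if y ∈ H then 0 else F y := by
    rw [← sum_eq_sum_subgroup (fun y => if y ∈ H then F y else 0) (fun y hy => if_neg hy) |>.trans
      (Finset.sum_congr rfl fun y _ => if_pos y.2), ← Finset.sum_add_distrib]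
    refine Finset.sum_congr rfl fun y _ => ?_
    split_ifs <;> simp
  have hF3 : (∑ y, if y ∈ H then 0 else F y) =
      (Nat.card C : ℂ) • (∑ g, of ℂ G g - subgroupIncl H (∑ g, of ℂ H g)) := by
    have h1 : ∑ g, of ℂ G g - subgroupIncl H (∑ g, of ℂ H g) =
        ∑ g, if g ∈ H then 0 else of ℂ G g := by
      rw [map_sum]
      simp only [subgroupIncl_of]
      rw [← sum_eq_sum_subgroup (fun y => if y ∈ H then of ℂ G y else 0)
        (fun y hy => if_neg hy) |>.trans (Finset.sum_congr rfl fun y _ => if_pos y.2),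
        ← Finset.sum_sub_distrib]
      refine Finset.sum_congr rfl fun y _ => ?_
      split_ifs <;> simp
    have h2 : (∑ y, if y ∈ H then 0 else F y) = ∑ g, ∑ y,
        if y ∉ H ∧ Commute (g⁻¹ * (y * s * y⁻¹)) s then of ℂ G g else 0 := by
      rw [Finset.sum_comm]
      refine Finset.sum_congr rfl fun y _ => ?_
      by_cases hy : y ∈ H <;> simp [hy, hF]
    rw [h1, h2, Finset.smul_sum]
    refine Finset.sum_congr rfl fun g _ => ?_
    split_ifs with hg
    · rw [smul_zero]
      refine Finset.sum_eq_zero fun y _ => if_neg fun ⟨hy, hc⟩ => hy (hE y ?_)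
      exact (H.mul_mem_cancel_left (H.inv_mem hg)).1 (hC _ hc)
    · obtain ⟨y₀, hy₀⟩ := hcos g hg
      have h3 (y : G) : (y ∉ H ∧ Commute (g⁻¹ * (y * s * y⁻¹)) s) ↔ Commute (y₀⁻¹ * y) s := by
        rw [hy₀, and_iff_right_iff_imp, ← hy₀]
        intro hc hy
        refine hg (H.inv_mem_iff.1 ?_)
        exact (H.mul_mem_cancel_right
          (H.mul_mem (H.mul_mem hy hs) (H.inv_mem hy))).1 (hC _ hc)
      simp only [h3]
      rw [hcard, Finset.sum_smul]
      refine Fintype.sum_equiv (Equiv.mulLeft y₀⁻¹) _ _ fun y => ?_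
      rw [Equiv.coe_mulLeft]
      split_ifs <;> simp
  rw [twistedAvg]
  simp only [one_smul, mul_smul_comm, map_smul, map_sum, subgroupIncl_of, _root_.map_mul]
  rw [conjSum, conjSum, map_sum, Finset.sum_mul, Finset.sum_mul]
  simp only [subgroupIncl_of]
  have hF4 (y : H) : of ℂ G (y * ⟨s, hs⟩ * y⁻¹ : H) * ∑ c : C, of ℂ G c = F y := hF1 y
  rw [Finset.sum_congr rfl fun y _ => hF1 y, Finset.sum_congr rfl fun y _ => hF4 y, hF2, hF3,
    smul_add, smul_smul, inv_mul_cancel₀ h0, one_smul, map_sum]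
  simp only [subgroupIncl_of]

end DihedralData

end Restriction

section Assembly

open MonoidAlgebra

theorem exists_nat_blockChar_add {A : Type*} [Ring A] [Algebra ℂ A] {n : ℕ} {d : Fin n → ℕ}
    [∀ i, NeZero (d i)] (e : A ≃ₐ[ℂ] Π i, Matrix (Fin (d i)) (Fin (d i)) ℂ) {τ : A →ₗ[ℂ] ℂ}
    (hτ : ∀ a b, τ (a * b) = τ (b * a)) (hnat : ∀ a, IsIdempotentElem a → ∃ k : ℕ, τ a = k)
    {i : Fin n} {c : ℕ} (hi : τ (blockIdem e i) = 1 + c) {q : A} (hq : IsIdempotentElem q) :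
    ∃ k m : ℕ, blockChar e i q = k ∧ τ q = k + m := by
  choose b hb using fun j => hnat _ (isIdempotentElem_blockIdem e j)
  choose k hk using fun j => exists_nat_blockChar e hq j
  refine ⟨k i, c * k i + ∑ j ∈ Finset.univ.erase i, b j * k j, hk i, ?_⟩
  rw [eq_sum_blockChar_of_mul_comm e τ hτ q,
    ← Finset.add_sum_erase _ _ (Finset.mem_univ i), hi]
  simp only [hb, hk]
  push_cast
  ring

namespace DihedralData

variable {G : Type*} [Group G] [Fintype G] {H : Subgroup G} [Fintype H] {s a : G} {K : Subgroup G}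
  {L : G → ℂ}

theorem sum_eq_of_constituents {n : ℕ} {d : Fin n → ℕ}
    {e : MonoidAlgebra ℂ G ≃ₐ[ℂ] Π i, Matrix (Fin (d i)) (Fin (d i)) ℂ} [∀ i, NeZero (d i)]
    {i₀ i₁ i₂ : Fin n} (h0 : ∀ x, blockChar e i₀ x = augmentation G x) (hd : d i₂ = d i₁ + 1)
    (hs : blockChar e i₂ (of ℂ G s) = blockChar e i₁ (of ℂ G s) - 3)
    (hf : ∀ f : Fin n → ℂ, ∑ i, blockChar e i (weightElt K L) * f i = f i₀ + f i₁ - f i₂)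
    {E : ℤ} (hE : blockChar e i₁ (of ℂ G s) = E) :
    (Nat.card G : ℂ) *
        ((1 + (E : ℝ) ^ 2 / (d i₁ : ℝ) - ((E : ℝ) - 3) ^ 2 / ((d i₁ : ℝ) + 1) : ℝ) : ℂ) =
      (Nat.card K : ℂ)⁻¹ * ∑ y, ∑ z, weight K L ((y * s * y⁻¹ * (z * s * z⁻¹))⁻¹) := by
  rw [← sum_blockChar_conjSum_sq e, hf, h0, augmentation_of, hs, hE, hd]
  have hd0 : (d i₀ : ℂ) = 1 := by
    rw [← blockChar_one e, h0, _root_.map_one]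
  rw [hd0]
  push_cast
  ring

theorem exists_degrees (h : DihedralData s a K L) (hs : s ∈ H) (ha : a ∈ H) (hK : K ≤ H)
    (hC : ∀ g, Commute g s → g ∈ H) (hE : ∀ g, g * s * g⁻¹ ∈ H → g ∈ H)
    (hcos : ∀ g ∉ H, ∃ y₀, ∀ y, Commute (g⁻¹ * (y * s * y⁻¹)) s ↔ Commute (y₀⁻¹ * y) s)
    (hconj : ∀ t ∈ H, t * t = 1 → t ≠ 1 → ∃ y ∈ H, y * s * y⁻¹ = t) :
    ∃ d e D E : ℤ, 0 < d ∧ |e| ≤ d ∧ |E - e| ≤ D - d ∧ H.index * E * d = e * D ∧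
      0 < 1 + (e : ℝ) ^ 2 / d - ((e : ℝ) - 3) ^ 2 / (d + 1) ∧
      (H.index : ℝ) * (1 + (E : ℝ) ^ 2 / D - ((E : ℝ) - 3) ^ 2 / (D + 1)) =
        1 + (e : ℝ) ^ 2 / d - ((e : ℝ) - 3) ^ 2 / (d + 1) := by
  obtain ⟨nG, dG, hdG, ⟨eG⟩⟩ := exists_blockEquiv G
  obtain ⟨nH, dH, hdH, ⟨eH⟩⟩ := exists_blockEquiv H
  have h' := h.subgroupOf hs ha hK
  obtain ⟨i₀, i₁, i₂, -, hi0, hi1, hid, his, hif⟩ := h.exists_constituents eG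
  obtain ⟨j₀, j₁, j₂, hj, hj0, hj1, hjd, hjs, hjf⟩ := h'.exists_constituents eH
  set ι := subgroupIncl H with hι
  set τ : MonoidAlgebra ℂ H →ₗ[ℂ] ℂ := (blockChar eG i₁).comp ι.toLinearMap with hτ
  have τ_apply (x) : τ x = blockChar eG i₁ (ι x) := rfl
  have τ_comm (x y) : τ (x * y) = τ (y * x) := by
    rw [τ_apply, τ_apply, _root_.map_mul ι, _root_.map_mul ι, blockChar_mul_comm]
  have τ_nat (x) (hx : IsIdempotentElem x) : ∃ k : ℕ, τ x = k :=
    exists_nat_blockChar eG (hx.map ι) i₁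
  have aug_ι (x) : augmentation G (ι x) = augmentation H x := by
    suffices ((augmentation G).comp ι).toLinearMap = (augmentation H).toLinearMap from
      LinearMap.congr_fun this x
    refine linearMap_ext_of fun g => ?_
    rw [AlgHom.toLinearMap_apply, AlgHom.toLinearMap_apply, AlgHom.comp_apply, hι,
      subgroupIncl_of, augmentation_of, augmentation_of]
  obtain ⟨c, hc⟩ : ∃ c : ℕ, τ (blockIdem eH j₁) = 1 + c := by
    obtain ⟨c, hc⟩ := exists_nat_blockChar eG ((isIdempotentElem_blockIdem eH j₁).map ι) i₂
    refine ⟨c, ?_⟩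
    have h1 := h.inducedFun_subgroupIncl hE hK (blockIdem eH j₁)
    rw [← sum_blockChar_weightElt eG, ← sum_blockChar_weightElt eH, hif, hi0, aug_ι, hc, ← hj0,
      blockChar_blockIdem, if_neg hj] at h1
    simp only [blockChar_blockIdem, mul_ite, mul_one, mul_zero, Finset.sum_ite_eq',
      Finset.mem_univ, if_true, hj1] at h1
    rw [τ_apply]
    linear_combination h1
  have hss : (⟨s, hs⟩ : H) * ⟨s, hs⟩ = 1 := h'.s_mul_s
  obtain ⟨k₁, m₁, hk₁, hm₁⟩ := exists_nat_blockChar_add eH τ_comm τ_nat hc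
    (isIdempotentElem_half_add hss 1 (by norm_num))
  obtain ⟨k₂, m₂, hk₂, hm₂⟩ := exists_nat_blockChar_add eH τ_comm τ_nat hc
    (isIdempotentElem_half_add hss (-1) (by norm_num))
  rw [τ_apply] at hm₁ hm₂
  simp only [map_smul, map_add, _root_.map_one, blockChar_one, smul_eq_mul, hι, subgroupIncl_of]
    at hk₁ hk₂ hm₁ hm₂
  have hd : (dH j₁ : ℤ) = k₁ + k₂ := by
    have : (dH j₁ : ℂ) = k₁ + k₂ := by linear_combination hk₁ + hk₂
    exact_mod_cast this
  have hD : (dG i₁ : ℤ) = k₁ + k₂ + m₁ + m₂ := by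
    have : (dG i₁ : ℂ) = k₁ + k₂ + m₁ + m₂ := by linear_combination hm₁ + hm₂
    exact_mod_cast this
  have he : blockChar eH j₁ (of ℂ H ⟨s, hs⟩) = ((k₁ - k₂ : ℤ) : ℂ) := by
    push_cast
    linear_combination hk₁ - hk₂
  have hEE : blockChar eG i₁ (of ℂ G s) = ((k₁ + m₁ - k₂ - m₂ : ℤ) : ℂ) := by
    push_cast
    linear_combination hm₁ - hm₂
  have hdpos : 0 < (dH j₁ : ℤ) := by exact_mod_cast Nat.pos_of_ne_zero (NeZero.ne (dH j₁))
  have hDpos : 0 < (dG i₁ : ℤ) := by exact_mod_cast Nat.pos_of_ne_zero (NeZero.ne (dG i₁))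
  have hcard : (Nat.card G : ℂ) = H.index * Nat.card H := by
    rw [← H.index_mul_card]; push_cast; rfl
  have hH0 : (Nat.card H : ℂ) ≠ 0 := Nat.cast_ne_zero.2 Nat.card_pos.ne'
  have haa : a * a = 1 := h.a_mul_a
  have has : Commute a s := (h.commute_iff a).2 (Or.inr (by rw [haa]; exact K.one_mem))
  obtain ⟨y₁, hy₁, hya⟩ := hconj a ha haa fun H => h.a_notMem (H ▸ K.one_mem)
  obtain ⟨y₂, hy₂, hyas⟩ := hconj (a * s) (H.mul_mem ha hs)
    (by rw [mul_assoc, ← mul_assoc s, ← has.eq, mul_assoc a, h.s_mul_s, mul_one, haa])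
    (fun H => h.a_notMem (by
      rw [mul_eq_one_iff_eq_inv, h.s_inv] at H
      exact H ▸ h.s_mem))
  set C : Subgroup H := Subgroup.centralizer {⟨s, hs⟩} with hCdef
  have hCm (g : H) : g ∈ C ↔ Commute g ⟨s, hs⟩ := by
    rw [hCdef, Subgroup.mem_centralizer_singleton_iff]
    exact ⟨fun h => h, fun h => h⟩
  have hgt := h'.one_lt_re_inducedFun hCm (y₀ := ⟨y₁, hy₁⟩) (Subtype.ext hya) (Subtype.ext has)
  set eC : MonoidAlgebra ℂ H := twistedAvg C fun _ => 1 with heC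
  have hCidem : IsIdempotentElem eC := isIdempotentElem_twistedAvg C _ (by simp)
  have hm1 : blockChar eH j₁ eC ≠ 0 := by
    intro h1
    obtain ⟨k, hk⟩ := exists_nat_blockChar eH hCidem j₂
    have h2 : augmentation H eC = 1 := by
      simp only [heC, twistedAvg, map_smul, map_sum, augmentation_of, smul_eq_mul]
      simp only [mul_one, Finset.sum_const, Finset.card_univ, nsmul_eq_mul]
      rw [Fintype.card_eq_nat_card, inv_mul_cancel₀ (Nat.cast_ne_zero.2 Nat.card_pos.ne')]
    rw [← sum_blockChar_weightElt eH, hjf, hj0, h1, hk, h2] at hgt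
    norm_num at hgt
    linarith [(Nat.cast_nonneg k : (0 : ℝ) ≤ k)]
  have hprod : (H.index : ℤ) * (k₁ + m₁ - k₂ - m₂) * dH j₁ = (k₁ - k₂) * dG i₁ := by
    have h1 := congrArg (· * ι (blockOne eH j₁))
      (conjSum_mul_centralizerAvg hs hC hE hcos hCm)
    have haug : augmentation H (blockOne eH j₁) = 0 := by
      rw [← hj0, ← mul_one (blockOne eH j₁), blockChar_blockOne_mul, if_neg hj]
    simp only [← hι, ← heC, add_mul, sub_mul, ← _root_.map_mul ι, sum_mul_eq_augmentation_smul,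
      aug_ι, haug, zero_smul, map_zero, sub_zero, add_zero] at h1
    rw [conjSum_mul_comm (⟨s, hs⟩ : H), mul_assoc eC,
      mul_blockOne_of_commute eH (conjSum_mul_comm _),
      mul_smul_comm, map_smul, mul_assoc (conjSum s), ← _root_.map_mul ι,
      blockChar_conjSum, he] at h1
    have hX : blockChar eG i₁ (ι (eC * blockOne eH j₁)) ≠ 0 := by
      rw [← τ_apply, τ_comm, eq_sum_blockChar_of_mul_comm eH τ τ_comm]
      simp only [blockChar_blockOne_mul, mul_ite, mul_zero, Finset.sum_ite_eq', Finset.mem_univ,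
        if_true]
      rw [hc]
      refine mul_ne_zero ?_ hm1
      exact_mod_cast (by omega : 1 + c ≠ 0)
    have h2 := blockChar_mul_blockChar_of_commute eG (conjSum_mul_comm s) i₁
      (ι (eC * blockOne eH j₁))
    rw [h1, map_smul, blockChar_conjSum, hEE, hcard, smul_eq_mul] at h2
    have hd0 : (dH j₁ : ℂ) ≠ 0 := Nat.cast_ne_zero.2 (NeZero.ne _)
    field_simp at h2
    rw [mul_comm (k₁ - k₂ : ℤ)]
    exact_mod_cast h2
  have hG := sum_eq_of_constituents hi0 hid his hif hEE
  have hH := sum_eq_of_constituents hj0 hjd hjs hjf he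
  rw [h.sum_weight_eq_sum_subgroup hs hE hC,
    ← Nat.card_congr (Subgroup.subgroupOfEquivOfLe hK).toEquiv, ← hH, hcard] at hG
  have hpos := h'.sum_weight_re_pos (y := ⟨y₁, hy₁⟩) (z := ⟨y₂, hy₂⟩) (Subtype.ext hya)
    (Subtype.ext hyas)
  refine ⟨dH j₁, k₁ - k₂, dG i₁, k₁ + m₁ - k₂ - m₂, hdpos, ?_, ?_, hprod, ?_, ?_⟩
  · rw [hd, abs_le]; omega
  · rw [hd, hD, abs_le]; omega
  · have h3 : ((Nat.card H : ℝ) * Nat.card (K.subgroupOf H) : ℂ) *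
        ((1 + ((k₁ - k₂ : ℤ) : ℝ) ^ 2 / (dH j₁ : ℝ) - (((k₁ - k₂ : ℤ) : ℝ) - 3) ^ 2 /
          ((dH j₁ : ℝ) + 1) : ℝ) : ℂ) = ∑ y : H, ∑ z : H, weight (K.subgroupOf H) (fun x => L x)
          ((y * ⟨s, hs⟩ * y⁻¹ * (z * ⟨s, hs⟩ * z⁻¹))⁻¹) := by
      have : (Nat.card (K.subgroupOf H) : ℂ) ≠ 0 := Nat.cast_ne_zero.2 Nat.card_pos.ne'
      rw [eq_inv_mul_iff_mul_eq₀ this] at hH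
      rw [← hH]
      push_cast
      ring
    rw [← h3, ← Complex.ofReal_natCast (Nat.card (K.subgroupOf H)), ← Complex.ofReal_mul,
      ← Complex.ofReal_mul, Complex.ofReal_re] at hpos
    exact_mod_cast pos_of_mul_pos_right hpos (by positivity)
  · rw [mul_right_comm, mul_comm (Nat.card H : ℂ)] at hG
    have h3 := mul_right_cancel₀ hH0 hG
    rw [← Complex.ofReal_natCast, ← Complex.ofReal_mul, Complex.ofReal_inj] at h3
    exact_mod_cast h3

end DihedralData

end Assembly

section Arithmetic

theorem degree_bound {n d f D F σ : ℤ} (hn : 0 < n) (hd : 0 < d) (hD : 0 < D) (hF : 0 < F)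
    (hσ : σ ^ 2 = 1) (hprod : n * F * d = f * D) (hA : 0 < d ^ 2 + 6 * σ * d * f - 8 * d + f ^ 2)
    (heq : n * (d * (d + 1)) * (D ^ 2 + 6 * σ * D * F - 8 * D + F ^ 2) =
      D * (D + 1) * (d ^ 2 + 6 * σ * d * f - 8 * d + f ^ 2)) :
    n * d ^ 2 * F < d ^ 2 * F + f ^ 2 * F + 9 * f * d := by
  have h1 : n * (D + 6 * σ * F - 9) * (d * (d + 1)) ≤
      D * (d ^ 2 + 6 * σ * d * f - 8 * d + f ^ 2) := by
    have : 0 ≤ n * (d * (d + 1)) * (F - 3 * σ) ^ 2 := by positivity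
    refine le_of_mul_le_mul_right ?_ (by omega : 0 < D + 1)
    linear_combination this + heq + 9 * n * (d * (d + 1)) * hσ
  have h2 : n * (D + 6 * σ * F - 9) * d ^ 2 < D * (d ^ 2 + 6 * σ * d * f + f ^ 2) := by
    refine lt_of_mul_lt_mul_right ?_ (by omega : 0 ≤ d + 1)
    have h3 := mul_le_mul_of_nonneg_right h1 hd.le
    have h4 := mul_pos hD hA
    have h5 : 0 < D * d * (d + 1) := by positivity
    linear_combination h3 + h4 + 8 * h5
  refine lt_of_mul_lt_mul_left ?_ hD.le
  have h3 := mul_lt_mul_of_pos_right h2 hF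
  linear_combination h3 - 6 * σ * d * F * hprod + 9 * d * hprod

theorem degree_check : ∀ n ∈ [9, 10], ∀ σ ∈ [-1, 1], ∀ D d f : Fin 13, (0 : ℤ) < d → (0 : ℤ) < f →
    (d : ℤ) + f ≤ D + 1 → (n : ℤ) * d = f * D →
    n * ((d : ℤ) * (d + 1)) * (D ^ 2 + 6 * σ * D - 8 * D + 1) ≠
      D * (D + 1) * (d ^ 2 + 6 * σ * d * f - 8 * d + f ^ 2) := by
  decide +kernel

theorem no_degrees {n d f D F σ : ℤ} (hn : 9 ≤ n) (hd : 0 < d) (hf : 0 < f) (hfd : f ≤ d)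
    (hD : 0 < D) (hFD : f - F ≤ D - d)
    (hσ : σ = -1 ∨ σ = 1) (hprod : n * F * d = f * D)
    (hA : 0 < d ^ 2 + 6 * σ * d * f - 8 * d + f ^ 2)
    (heq : n * (d * (d + 1)) * (D ^ 2 + 6 * σ * D * F - 8 * D + F ^ 2) =
      D * (D + 1) * (d ^ 2 + 6 * σ * d * f - 8 * d + f ^ 2)) : False := by
  have hF : 0 < F := by
    have : 0 < n * F * d := hprod ▸ mul_pos hf hD
    have h2 := pos_of_mul_pos_left this hd.le
    exact pos_of_mul_pos_right h2 (by omega)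
  have hb := degree_bound (by omega) hd hD hF (by rcases hσ with rfl | rfl <;> rfl) hprod hA heq
  have hF1 : F = 1 := by
    by_contra h
    have h2 : 2 ≤ F := by omega
    nlinarith [mul_le_mul hfd hfd hf.le hd.le, mul_le_mul_of_nonneg_right hfd hd.le,
      mul_pos hd hd, mul_le_mul_of_nonneg_right h2 (mul_pos hd hd).le,
      mul_le_mul_of_nonneg_right hn (mul_pos (mul_pos hd hd) hF).le]
  subst hF1
  have h4 : 4 * d < 5 * f := by nlinarith
  have hn10 : n ≤ 10 := by
    by_contra h
    nlinarith [mul_le_mul_of_nonneg_right (by omega : 11 ≤ n) (mul_pos hd hd).le]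
  have hD12 : D < 13 := by
    by_contra h
    nlinarith
  lift d to ℕ using hd.le
  lift f to ℕ using hf.le
  lift D to ℕ using hD.le
  refine degree_check n (by simp; omega) σ (by simpa using hσ) ⟨D, by omega⟩ ⟨d, by omega⟩
    ⟨f, by omega⟩ hd hf ?_ ?_ ?_
  · simp only
    omega
  · rw [mul_one] at hprod
    exact hprod
  · rw [mul_one, one_pow] at heq
    exact heq

theorem no_strongly_embedded_degrees {n : ℕ} (hn : 9 ≤ n) {d e D E : ℤ} (hd : 0 < d)
    (hed : |e| ≤ d) (hED : |E - e| ≤ D - d) (hprod : n * E * d = e * D)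
    (hpos : 0 < 1 + (e : ℝ) ^ 2 / d - ((e : ℝ) - 3) ^ 2 / (d + 1))
    (heq : (n : ℝ) * (1 + (E : ℝ) ^ 2 / D - ((E : ℝ) - 3) ^ 2 / (D + 1)) =
      1 + (e : ℝ) ^ 2 / d - ((e : ℝ) - 3) ^ 2 / (d + 1)) : False := by
  have hD : 0 < D := by linarith [abs_nonneg (E - e)]
  have hd' : (0 : ℝ) < d := by exact_mod_cast hd
  have hD' : (0 : ℝ) < D := by exact_mod_cast hD
  have key (x y : ℝ) (hx : 0 < x) : 1 + y ^ 2 / x - (y - 3) ^ 2 / (x + 1) =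
      (x ^ 2 + 6 * x * y - 8 * x + y ^ 2) / (x * (x + 1)) := by
    have : x + 1 ≠ 0 := by positivity
    field_simp
    ring
  rw [key _ _ hd'] at hpos heq
  rw [key _ _ hD', mul_div_assoc', div_eq_div_iff (by positivity) (by positivity)] at heq
  have hA : 0 < d ^ 2 + 6 * d * e - 8 * d + e ^ 2 := by
    have := (div_pos_iff_of_pos_right (by positivity)).1 hpos
    exact_mod_cast this
  have heq' : n * (D ^ 2 + 6 * D * E - 8 * D + E ^ 2) * (d * (d + 1)) =
      (d ^ 2 + 6 * d * e - 8 * d + e ^ 2) * (D * (D + 1)) := by exact_mod_cast heq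
  have hn' : (9 : ℤ) ≤ n := by exact_mod_cast hn
  obtain ⟨h1, h2⟩ := abs_le.1 hed
  obtain ⟨h3, h4⟩ := abs_le.1 hED
  rcases lt_trichotomy e 0 with he | rfl | he
  · refine no_degrees (σ := -1) (f := -e) (F := -E) (D := D) hn' hd (by omega) (by omega) hD
      (by omega) (by simp)
      ?_ ?_ ?_
    · linear_combination -hprod
    · linear_combination hA
    · linear_combination heq'
  · have hE : E = 0 := by
      rw [zero_mul] at hprod
      have : n ≠ 0 := by omega
      simpa [hd.ne', this] using hprod
    subst hE
    have h5 : (n * (D - 8) * (d + 1) - (d - 8) * (D + 1)) * (d * D) = 0 := by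
      linear_combination heq'
    have h6 := (mul_eq_zero.1 h5).resolve_right (mul_pos hd hD).ne'
    have hd8 : 0 < d - 8 := by
      refine pos_of_mul_pos_right ?_ hd.le
      linear_combination hA
    have hDd : d ≤ D := by simpa using h4
    have h7 := mul_pos (by omega : 0 < D - 8) (by omega : 0 < d + 1)
    nlinarith
  · refine no_degrees (σ := 1) (f := e) (F := E) (D := D) hn' hd he h2 hD (by omega) (by simp)
      ?_ ?_ ?_
    · linear_combination hprod
    · linear_combination hA
    · linear_combination heq'

end Arithmetic

section GroupTheory

open Subgroup

theorem exists_hom_of_cyclic_sylow {K : Type*} [Group K] [Finite K] {x : K} {j : ℕ} (hj : j ≠ 0)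
    (hx : orderOf x = 2 ^ j) (hodd : ¬ 2 ∣ (zpowers x).index) :
    ∃ ψ : K →* ℂ, (∀ k, ψ k ^ 2 ^ j = 1) ∧ IsPrimitiveRoot (ψ x) (2 ^ j) ∧
      ∀ k, ψ k = 1 → Odd (orderOf k) := by
  have hpg : IsPGroup 2 (zpowers x) := IsPGroup.of_card (n := j) (by rw [Nat.card_zpowers, hx])
  let P : Sylow 2 K := hpg.toSylow hodd
  have hPx : (P : Subgroup K) = zpowers x := rfl
  have hxP : x ∈ P := mem_zpowers x
  have hcyc : IsCyclic P := inferInstanceAs (IsCyclic (zpowers x))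
  have hmin : (Nat.card K).minFac = 2 := by
    rw [Nat.minFac_eq_two_iff]
    exact (dvd_pow_self 2 hj).trans (hx ▸ orderOf_dvd_natCard x)
  have hP := hcyc.normalizer_le_centralizer hmin
  let t := MonoidHom.transferSylow P hP
  have htx : t x = ⟨x, hxP⟩ ^ (P : Subgroup K).index :=
    MonoidHom.transferSylow_eq_pow P hP x hxP
  have hζ := Complex.isPrimitiveRoot_exp (2 ^ j) (by positivity)
  set ζ := Complex.exp (2 * Real.pi * Complex.I / (2 ^ j : ℕ)) with hζdef
  let u : ℂˣ := (hζ.isUnit (by positivity)).unit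
  have hu : IsPrimitiveRoot u (2 ^ j) := IsPrimitiveRoot.coe_units_iff.1 hζ
  have hgen : ∀ y : P, y ∈ zpowers (⟨x, hxP⟩ : P) := by
    rintro ⟨y, hy⟩
    obtain ⟨i, hi⟩ := mem_zpowers_iff.1 hy
    exact mem_zpowers_iff.2 ⟨i, Subtype.ext hi⟩
  have hxo : orderOf (⟨x, hxP⟩ : P) = 2 ^ j := by rw [← hx, Subgroup.orderOf_mk]
  let η : P →* ℂˣ := monoidHomOfForallMemZpowers hgen (g' := u) (by rw [hxo, ← hu.eq_orderOf])
  have hη : η ⟨x, hxP⟩ = u := monoidHomOfForallMemZpowers_apply_gen _ _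
  refine ⟨(Units.coeHom ℂ).comp (η.comp t), fun k => ?_, ?_, fun k hk => ?_⟩
  · rw [← map_pow, MonoidHom.comp_apply, MonoidHom.comp_apply, map_pow]
    obtain ⟨i, hi⟩ := mem_zpowers_iff.1 (hgen (t k))
    rw [← hi, ← zpow_natCast, ← zpow_mul, mul_comm, zpow_mul, zpow_natCast, ← hxo,
      pow_orderOf_eq_one, one_zpow, map_one, map_one]
  · rw [MonoidHom.comp_apply, MonoidHom.comp_apply, htx, map_pow, hη, map_pow]
    refine IsPrimitiveRoot.pow_of_coprime hζ _ ?_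
    exact Nat.Coprime.pow_right _ ((Nat.prime_two.coprime_iff_not_dvd.2 hodd).symm)
  · rw [MonoidHom.comp_apply, MonoidHom.comp_apply, Units.coeHom_apply, Units.val_eq_one] at hk
    have htk : t k = 1 := by
      obtain ⟨i, hi⟩ := mem_zpowers_iff.1 (hgen (t k))
      rw [← hi, map_zpow, hη, hu.zpow_eq_one_iff_dvd] at hk
      rw [← hi, ← orderOf_dvd_iff_zpow_eq_one, hxo]
      exact hk
    have h1 : ¬ 2 ∣ Nat.card t.ker := MonoidHom.not_dvd_card_ker_transferSylow P hP
    rw [← Nat.not_even_iff_odd, even_iff_two_dvd]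
    exact fun h => h1 (h.trans (Subgroup.orderOf_dvd_natCard _ (MonoidHom.mem_ker.2 htk)))

theorem Equiv.Perm.sign_eq_neg_one_of_fixedPointFree {α : Type*} [Fintype α] [DecidableEq α]
    {σ : Equiv.Perm α} (hσ : σ * σ = 1) (hfix : ∀ x, σ x ≠ x) {q : ℕ} (hq : Odd q)
    (hα : Fintype.card α = 2 * q) : Equiv.Perm.sign σ = -1 := by
  have hne : Nonempty α := Fintype.card_pos_iff.1 (by have := hq.pos; omega)
  have ho : orderOf σ = 2 := orderOf_eq_prime (by rw [pow_two, hσ]) fun h => by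
    obtain ⟨x⟩ := hne
    exact hfix x (by rw [h]; rfl)
  obtain ⟨n, hn⟩ := cycleType_prime_order (σ := σ) (ho ▸ Nat.prime_two)
  have hs := sum_cycleType σ
  have hsupp : σ.support = Finset.univ := by
    ext x; simpa using hfix x
  rw [hsupp, Finset.card_univ, hα] at hs
  rw [sign_of_cycleType, hs]
  rw [hn, ho, Multiset.sum_replicate, smul_eq_mul] at hs
  rw [hn, Multiset.card_replicate, (by omega : n + 1 = q), pow_add, pow_mul, hq.neg_one_pow]
  simp

end GroupTheory

section GroupTheory

open Subgroup

theorem exists_subgroup_of_dihedral {Γ : Type*} [Group Γ] [Finite Γ] {x a s : Γ} {j q : ℕ}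
    (hx : orderOf x = 2 ^ j) (hq : Odd q) (hcard : Nat.card Γ = 2 * (2 ^ j * q))
    (hxs : ∀ y ∈ zpowers x, y * y = 1 → y = 1 ∨ y = s) (hs : ∀ g, Commute g s)
    (ha : a * a = 1) (hax : a ∉ zpowers x) (haxa : a * x * a = x⁻¹) :
    ∃ K : Subgroup Γ, a ∉ K ∧ x ∈ K ∧ (∀ g, g ∈ K ∨ a * g ∈ K) ∧ (∀ k ∈ K, a * k * a ∈ K) ∧
      ((zpowers x).subgroupOf K).index = q := by
  classical
  have := Fintype.ofFinite (Γ ⧸ zpowers x)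
  have hidx : (zpowers x).index = 2 * q := by
    have h1 := (zpowers x).card_mul_index
    rw [Nat.card_zpowers, hx, hcard] at h1
    exact Nat.eq_of_mul_eq_mul_left (by positivity) (h1.trans (by ring))
  let f : Γ →* ℤˣ := Equiv.Perm.sign.comp (MulAction.toPermHom Γ (Γ ⧸ zpowers x))
  have hneg (b : Γ) (hb : b * b = 1) (hbx : b ∉ zpowers x) : f b = -1 := by
    refine Equiv.Perm.sign_eq_neg_one_of_fixedPointFree (by rw [← map_mul, hb, map_one])
      (fun y => ?_) hq (by rw [← Nat.card_eq_fintype_card]; exact hidx)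
    obtain ⟨g, rfl⟩ := QuotientGroup.mk_surjective y
    intro h
    have h1 : (QuotientGroup.mk (b * g) : Γ ⧸ zpowers x) = QuotientGroup.mk g := h
    have h2 : g⁻¹ * b * g ∈ zpowers x := by
      rw [mul_assoc]
      exact QuotientGroup.eq.1 h1.symm
    have h3 : g⁻¹ * b * g * (g⁻¹ * b * g) = 1 := by
      rw [show g⁻¹ * b * g * (g⁻¹ * b * g) = g⁻¹ * (b * b) * g by group, hb]
      group
    have h4 : Commute g (g⁻¹ * b * g) := by
      rcases hxs _ h2 h3 with h | h <;> rw [h]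
      · exact Commute.one_right g
      · exact hs g
    have h5 : b = g⁻¹ * b * g := by
      have : g * (g⁻¹ * b * g) = b * g := by group
      rw [h4.eq] at this
      exact (mul_right_cancel this).symm
    exact hbx (h5 ▸ h2)
  have hfa : f a = -1 := hneg a ha hax
  have hfx : f x = 1 := by
    have h1 : f (a * x) = -1 := by
      refine hneg _ ?_ fun h => hax ((mul_mem_cancel_right (mem_zpowers x)).1 h)
      rw [← mul_assoc, haxa, inv_mul_cancel]
    rw [map_mul, hfa] at h1
    simpa using h1
  have hK (g : Γ) : g ∈ f.ker ∨ a * g ∈ f.ker := by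
    rw [MonoidHom.mem_ker, MonoidHom.mem_ker, map_mul, hfa]
    rcases Int.units_eq_one_or (f g) with h | h <;> simp [h]
  refine ⟨f.ker, ?_, hfx, hK, fun k hk => ?_, ?_⟩
  · rw [MonoidHom.mem_ker, hfa]
    decide
  · rw [MonoidHom.mem_ker] at hk ⊢
    simp [hk, hfa]
  · have h1 : f.ker.index = 2 := by
      rw [Subgroup.index_eq_two_iff_exists_notMem_and']
      refine ⟨a, ?_, fun g => (hK g).symm⟩
      rw [MonoidHom.mem_ker, hfa]
      decide
    have h2 := relIndex_mul_index (show zpowers x ≤ f.ker by rwa [zpowers_le])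
    rw [h1, hidx, relIndex] at h2
    omega
theorem dihedralData_of_map {G : Type*} [Group G] [Finite G] {K : Subgroup G} {x a s : G} {j : ℕ}
    (hj : 2 ≤ j) (hx : orderOf x = 2 ^ j) (hs : s = x ^ 2 ^ (j - 1)) (ha : a * a = 1)
    (haxa : a * x * a = x⁻¹) (haK : a ∉ K) (hxK : x ∈ K)
    (hC : ∀ g, Commute g s ↔ g ∈ K ∨ a * g ∈ K) (hconj : ∀ k ∈ K, a * k * a ∈ K) {L : G → ℂ}
    (hmul : ∀ k ∈ K, ∀ l ∈ K, L (k * l) = L k * L l) (hpow : ∀ k ∈ K, L k ^ 2 ^ j = 1)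
    (hLx : IsPrimitiveRoot (L x) (2 ^ j)) (hodd : ∀ k ∈ K, L k = 1 → Odd (orderOf k)) :
    DihedralData s a K L := by
  have hL0 (k : G) (hk : k ∈ K) : L k ≠ 0 := by
    intro h
    have := hpow k hk
    rw [h, zero_pow (by positivity)] at this
    exact zero_ne_one this
  have hL1 : L 1 = 1 := by
    have := hmul 1 K.one_mem 1 K.one_mem
    rw [mul_one] at this
    exact (mul_left_cancel₀ (hL0 1 K.one_mem) (this.symm.trans (mul_one _).symm))
  have hLpow (k : G) (hk : k ∈ K) (n : ℕ) : L (k ^ n) = L k ^ n := by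
    induction n with
    | zero => simp [hL1]
    | succ n ih => rw [pow_succ, hmul _ (K.pow_mem hk n) _ hk, ih, pow_succ]
  have hainv : a⁻¹ = a := inv_eq_of_mul_eq_one_left ha
  have hcp (k : G) (n : ℕ) : (a * k * a) ^ n = a * k ^ n * a := by
    have := conj_pow (i := n) (a := a) (b := k)
    rwa [hainv] at this
  have hL_one (k : G) (hk : k ∈ K) {m : ℕ} (hm : Odd m) (hkm : k ^ m = 1) : L k = 1 := by
    have h1 : L k ^ m = 1 := by rw [← hLpow k hk, hkm, hL1]
    have h2 := pow_gcd_eq_one.2 ⟨h1, hpow k hk⟩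
    rwa [(hm.coprime_two_right.pow_right j : Nat.gcd m (2 ^ j) = 1), pow_one] at h2
  have hsK : s ∈ K := hs ▸ K.pow_mem hxK _
  have hj2 : 2 ^ j = 2 ^ (j - 1) * 2 := by
    rw [← pow_succ]
    congr 1
    omega
  have hLs : L s = -1 := by
    rw [hs, hLpow x hxK]
    exact (hLx.pow (by positivity) hj2).eq_neg_one_of_two_right
  have hss : s * s = 1 := by
    rw [hs, ← pow_add, ← mul_two, ← hj2, ← hx, pow_orderOf_eq_one]
  have hs1 : s ≠ 1 := by
    rintro h
    rw [h, hL1] at hLs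
    norm_num at hLs
  have hinv_one (k : G) (hk : k ∈ K) (hkk : k * k = 1) (hLk : L k = 1) : k = 1 := by
    have h1 := pow_gcd_eq_one.2 ⟨pow_orderOf_eq_one k, (pow_two k).trans hkk⟩
    rwa [((hodd k hk hLk).coprime_two_right : Nat.gcd _ 2 = 1), pow_one] at h1
  have heq (k : G) (hk : k ∈ K) (hkk : k * k = 1) : k = 1 ∨ k = s := by
    have h1 : L k * L k = 1 := by rw [← hmul k hk k hk, hkk, hL1]
    rcases mul_self_eq_one_iff.1 h1 with h | h
    · exact Or.inl (hinv_one k hk hkk h)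
    · right
      have hc : k * s = s * k := (hC k).2 (Or.inl hk)
      have h2 : k * s = 1 := by
        refine hinv_one _ (K.mul_mem hk hsK) ?_ (by rw [hmul k hk s hsK, h, hLs]; norm_num)
        rw [show k * s * (k * s) = k * (s * k) * s by group, ← hc,
          show k * (k * s) * s = k * k * (s * s) by group, hkk, hss, mul_one]
      rw [eq_inv_of_mul_eq_one_left h2, inv_eq_of_mul_eq_one_left hss]
  refine ⟨hss, hs1, ha, haK, hsK, hC, hmul, hLs,
    fun k hk => Complex.norm_eq_one_of_pow_eq_one (hpow k hk) (by positivity), hconj,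
    fun k hk => ?_, fun k hk hLk => ?_, heq, x, hxK, fun h => ?_⟩
  · have : NeZero (2 ^ j) := ⟨by positivity⟩
    obtain ⟨i, -, hi⟩ := hLx.eq_pow_of_pow_eq_one (hpow k hk)
    have hxi := K.pow_mem hxK i
    have hnK : (x ^ i)⁻¹ * k ∈ K := K.mul_mem (K.inv_mem hxi) hk
    have hk' : k = x ^ i * ((x ^ i)⁻¹ * k) := by group
    have hLn : L ((x ^ i)⁻¹ * k) = 1 := by
      have h1 := hmul _ hxi _ hnK
      rw [← hk', hLpow x hxK, hi] at h1
      exact (mul_left_cancel₀ (hL0 k hk) (h1.symm.trans (mul_one _).symm))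
    have hLan : L (a * ((x ^ i)⁻¹ * k) * a) = 1 := by
      refine hL_one _ (hconj _ hnK) (hodd _ hnK hLn) ?_
      rw [hcp, pow_orderOf_eq_one, mul_one, ha]
    have hax : a * x ^ i * a = (x ^ i)⁻¹ := by rw [← hcp, haxa, inv_pow]
    have h2 : a * k * a = (x ^ i)⁻¹ * (a * ((x ^ i)⁻¹ * k) * a) := by
      calc a * k * a = a * x ^ i * 1 * ((x ^ i)⁻¹ * k) * a := by group
        _ = a * x ^ i * a * (a * ((x ^ i)⁻¹ * k) * a) := by rw [← ha]; group
        _ = _ := by rw [hax]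
    rw [h2, hmul _ (K.inv_mem hxi) _ (hconj _ hnK), hLan, mul_one]
    refine eq_inv_of_mul_eq_one_left ?_
    rw [← hi, ← hLpow x hxK, ← hmul _ (K.inv_mem hxi) _ hxi, inv_mul_cancel, hL1]
  · have hev : ¬ Odd (orderOf k) := fun h => hLk (hL_one k hk h (pow_orderOf_eq_one k))
    obtain ⟨m, hm⟩ := Nat.not_odd_iff_even.1 hev
    have hpos := orderOf_pos k
    rcases heq (k ^ m) (K.pow_mem hk m) (by rw [← pow_add, ← hm, pow_orderOf_eq_one]) with h | h
    · exact absurd (orderOf_le_of_pow_eq_one (by omega) h) (by omega)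
    · exact h ▸ npow_mem_zpowers k m
  · have h1 := Nat.le_of_dvd (by norm_num) (hLx.dvd_of_pow_eq_one 2 h)
    have h2 : 2 ^ 2 ≤ 2 ^ j := Nat.pow_le_pow_right (by norm_num) hj
    omega

theorem exists_dihedralData {G : Type*} [Group G] [Finite G] {x a s : G} {j q : ℕ} (hj : 2 ≤ j)
    (hx : orderOf x = 2 ^ j) (hs : s = x ^ 2 ^ (j - 1)) (ha : a * a = 1) (hax : a ∉ zpowers x)
    (haxa : a * x * a = x⁻¹) (hcard : Nat.card (centralizer {s}) = 2 * (2 ^ j * q)) (hq : Odd q) :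
    ∃ (K : Subgroup G) (L : G → ℂ), DihedralData s a K L := by
  have hj2 : 2 ^ j = 2 ^ (j - 1) * 2 := by
    rw [← pow_succ]
    congr 1
    omega
  have hss : s * s = 1 := by
    rw [hs, ← pow_add, ← mul_two, ← hj2, ← hx, pow_orderOf_eq_one]
  have hainv : a⁻¹ = a := inv_eq_of_mul_eq_one_left ha
  have hmem (g : G) : g ∈ centralizer {s} ↔ Commute g s := by
    rw [mem_centralizer_singleton_iff]
    exact ⟨fun h => h, fun h => h⟩
  have hxC : x ∈ centralizer {s} := by
    rw [hmem, hs]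
    exact Commute.self_pow x _
  have haC : a ∈ centralizer {s} := by
    have h1 : a * s * a = s := by
      have := conj_pow (i := 2 ^ (j - 1)) (a := a) (b := x)
      rw [hainv, haxa, inv_pow, ← hs, inv_eq_of_mul_eq_one_left hss] at this
      exact this.symm
    rw [hmem]
    have h2 : a * s * a * a = s * a := by rw [h1]
    rwa [mul_assoc (a * s), ha, mul_one] at h2
  have hxs (y : G) (hy : y ∈ zpowers x) (hyy : y * y = 1) : y = 1 ∨ y = s := by
    obtain ⟨i, rfl⟩ := mem_powers_iff_mem_zpowers.2 hy
    change x ^ i * x ^ i = 1 at hyy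
    change x ^ i = 1 ∨ x ^ i = s
    rw [← pow_add, ← orderOf_dvd_iff_pow_eq_one, hx, hj2, ← mul_two] at hyy
    obtain ⟨c, rfl⟩ := Nat.dvd_of_mul_dvd_mul_right (by norm_num) hyy
    rw [pow_mul, ← hs]
    rcases Nat.even_or_odd' c with ⟨d, rfl | rfl⟩
    · left
      rw [pow_mul, pow_two, hss, one_pow]
    · right
      rw [pow_succ, pow_mul, pow_two, hss, one_pow, one_mul]
  have hsC : s ∈ centralizer {s} := (hmem s).2 (Commute.refl s)
  obtain ⟨K, haK, hxK, hK, hconj, hidx⟩ := exists_subgroup_of_dihedral (Γ := centralizer {s})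
    (x := ⟨x, hxC⟩) (a := ⟨a, haC⟩) (s := ⟨s, hsC⟩) (j := j) (q := q)
    (by rw [Subgroup.orderOf_mk, hx]) hq hcard
    (fun y hy hyy => by
      rcases hxs y (by
        obtain ⟨i, rfl⟩ := mem_zpowers_iff.1 hy
        exact mem_zpowers_iff.2 ⟨i, by simp⟩) (by simpa using congrArg Subtype.val hyy) with h | h
      · exact Or.inl (Subtype.ext h)
      · exact Or.inr (Subtype.ext h))
    (fun g => Subtype.ext ((hmem g).1 g.2)) (Subtype.ext ha)
    (fun h => hax (by
      obtain ⟨i, hi⟩ := mem_zpowers_iff.1 h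
      exact mem_zpowers_iff.2 ⟨i, by simpa using congrArg Subtype.val hi⟩))
    (Subtype.ext haxa)
  have hz : (zpowers (⟨x, hxC⟩ : centralizer {s})).subgroupOf K =
      zpowers (⟨⟨x, hxC⟩, hxK⟩ : K) := by
    ext k
    rw [mem_subgroupOf, mem_zpowers_iff, mem_zpowers_iff]
    exact exists_congr fun i => by simp [Subtype.ext_iff]
  obtain ⟨ψ, hψ, hψx, hψodd⟩ := exists_hom_of_cyclic_sylow (K := K) (x := ⟨⟨x, hxC⟩, hxK⟩)
    (j := j) (by omega) (by rw [Subgroup.orderOf_mk, Subgroup.orderOf_mk, hx])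
    (by rw [← hz, hidx]; exact hq.not_two_dvd_nat)
  have hinj : Function.Injective fun k : K => ((k : centralizer {s}) : G) :=
    Subtype.val_injective.comp Subtype.val_injective
  have hmap (g : G) (hg : g ∈ K.map (centralizer {s}).subtype) :
      ∃ k : K, ((k : centralizer {s}) : G) = g := by
    obtain ⟨k, hk, rfl⟩ := hg
    exact ⟨⟨k, hk⟩, rfl⟩
  have hmap' (k : centralizer {s}) : (k : G) ∈ K.map (centralizer {s}).subtype ↔ k ∈ K :=
    mem_map_iff_mem Subtype.val_injective
  have hL (k : K) : Function.extend (fun k : K => ((k : centralizer {s}) : G)) ψ 0 k = ψ k :=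
    hinj.extend_apply _ _ k
  refine ⟨K.map (centralizer {s}).subtype,
    Function.extend (fun k : K => ((k : centralizer {s}) : G)) ψ 0,
    dihedralData_of_map hj hx hs ha haxa (fun h => haK ((hmap' ⟨a, haC⟩).1 h))
      ((hmap' ⟨x, hxC⟩).2 hxK) (fun g => ⟨fun h => ?_, fun h => ?_⟩) (fun k hk => ?_)
      (fun k hk l hl => ?_) (fun k hk => ?_) ?_ (fun k hk h => ?_)⟩
  · exact (hK ⟨g, (hmem g).2 h⟩).imp (hmap' ⟨g, (hmem g).2 h⟩).2
      (hmap' (⟨a, haC⟩ * ⟨g, (hmem g).2 h⟩)).2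
  · rw [← hmem]
    rcases h with h | h
    · obtain ⟨k, rfl⟩ := hmap _ h
      exact k.1.2
    · obtain ⟨k, hk⟩ := hmap _ h
      exact ((centralizer {s}).mul_mem_cancel_left haC).1 (hk ▸ k.1.2)
  · obtain ⟨k, rfl⟩ := hmap _ hk
    exact (hmap' (⟨a, haC⟩ * k * ⟨a, haC⟩)).2 (hconj k k.2)
  · obtain ⟨k, rfl⟩ := hmap _ hk
    obtain ⟨l, rfl⟩ := hmap _ hl
    rw [hL, hL, ← map_mul, ← hL]
    rfl
  · obtain ⟨k, rfl⟩ := hmap _ hk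
    rw [hL, hψ]
  · exact (hL ⟨⟨x, hxC⟩, hxK⟩).symm ▸ hψx
  · obtain ⟨k, rfl⟩ := hmap _ hk
    rw [hL] at h
    rw [Subgroup.orderOf_coe, Subgroup.orderOf_coe]
    exact hψodd k h

end GroupTheory

section StronglyEmbedded

open Subgroup

variable {G : Type*} [Group G] {H : Subgroup G}

/-- Every element conjugating an involution of `H` into `H` lies in `H`. -/
def ControlsInvolutions (H : Subgroup G) : Prop :=
  ∀ s ∈ H, s * s = 1 → s ≠ 1 → ∀ g, g * s * g⁻¹ ∈ H → g ∈ H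

namespace ControlsInvolutions

theorem mem_of_commute (hH : ControlsInvolutions H) {s g : G} (hs : s ∈ H) (hss : s * s = 1)
    (hs1 : s ≠ 1) (hg : Commute g s) : g ∈ H :=
  hH s hs hss hs1 g (by rwa [hg.eq, mul_inv_cancel_right])

variable [Finite G]

theorem exists_pow_conj_eq (hH : ControlsInvolutions H) {s v : G} (hs : s ∈ H) (hss : s * s = 1)
    (hs1 : s ≠ 1) (hv : v ∉ H) (hvv : v * v = 1) :
    ∃ k : ℕ, (s * v) ^ k * s * ((s * v) ^ k)⁻¹ = v := by
  have hsi : s⁻¹ = s := inv_eq_of_mul_eq_one_left hss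
  have hvi : v⁻¹ = v := inv_eq_of_mul_eq_one_left hvv
  have hsw (n : ℕ) : s * (s * v) ^ n * s⁻¹ = ((s * v) ^ n)⁻¹ := by
    rw [← conj_pow, ← inv_pow, mul_inv_rev, hsi, hvi, ← mul_assoc, hss, one_mul]
  have hvw (n : ℕ) : v * (s * v) ^ n * v⁻¹ = ((s * v) ^ n)⁻¹ := by
    rw [← conj_pow, ← inv_pow, mul_inv_rev, hsi, hvi, mul_assoc, mul_assoc, hvv, mul_one]
  rcases Nat.even_or_odd' (orderOf (s * v)) with ⟨r, hr | hr⟩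
  · exfalso
    have hpos := orderOf_pos (s * v)
    have hzz : (s * v) ^ r * (s * v) ^ r = 1 := by
      rw [← pow_add, ← two_mul, ← hr, pow_orderOf_eq_one]
    have hz1 : (s * v) ^ r ≠ 1 := fun h =>
      absurd (orderOf_le_of_pow_eq_one (by omega) h) (by omega)
    have hzi := inv_eq_of_mul_eq_one_left hzz
    have hzs : Commute ((s * v) ^ r) s := by
      have := hsw r
      rw [hzi, mul_inv_eq_iff_eq_mul] at this
      exact this.symm
    have hzv : Commute v ((s * v) ^ r) := by
      have := hvw r
      rwa [hzi, mul_inv_eq_iff_eq_mul] at this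
    exact hv (hH.mem_of_commute (hH.mem_of_commute hs hss hs1 hzs) hzz hz1 hzv)
  · refine ⟨r, ?_⟩
    have h1 : s * ((s * v) ^ r)⁻¹ = (s * v) ^ r * s := by
      rw [← hsw r]
      simp only [hsi, ← mul_assoc, hss, one_mul]
    have h2 : (s * v) ^ r * (s * v) ^ r * (s * v) = 1 := by
      rw [← pow_add, ← two_mul, ← pow_succ, ← hr, pow_orderOf_eq_one]
    rw [mul_assoc, h1, ← mul_assoc, eq_inv_of_mul_eq_one_left h2, mul_inv_rev, hsi, hvi, mul_assoc,
      hss, mul_one]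

theorem eq_one_of_commute_of_inv (hH : ControlsInvolutions H) {s v x : G} (hs : s ∈ H)
    (hss : s * s = 1) (hs1 : s ≠ 1) (hv : v ∉ H) (hvv : v * v = 1) (hx : Commute x s)
    (hvx : v * x * v = x⁻¹) : x = 1 := by
  have hsi : s⁻¹ = s := inv_eq_of_mul_eq_one_left hss
  have hvi : v⁻¹ = v := inv_eq_of_mul_eq_one_left hvv
  obtain ⟨k, hk⟩ := hH.exists_pow_conj_eq hs hss hs1 hv hvv
  have hw : (s * v)⁻¹ * x * (s * v) = x⁻¹ := by
    calc (s * v)⁻¹ * x * (s * v) = v⁻¹ * (s⁻¹ * (x * s)) * v := by group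
      _ = x⁻¹ := by rw [hx.eq, inv_mul_cancel_left, hvi, hvx]
  have hpow (n : ℕ) : ((s * v) ^ n)⁻¹ * x * (s * v) ^ n = x ∨
      ((s * v) ^ n)⁻¹ * x * (s * v) ^ n = x⁻¹ := by
    induction n with
    | zero => simp
    | succ n ih =>
      have h1 : ((s * v) ^ (n + 1))⁻¹ * x * (s * v) ^ (n + 1) =
          (s * v)⁻¹ * (((s * v) ^ n)⁻¹ * x * (s * v) ^ n) * (s * v) := by
        rw [pow_succ]
        group
      rw [h1]
      rcases ih with h | h <;> rw [h]
      · exact Or.inr hw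
      · left
        calc (s * v)⁻¹ * x⁻¹ * (s * v) = ((s * v)⁻¹ * x * (s * v))⁻¹ := by group
          _ = x := by rw [hw, inv_inv]
  have hcs : Commute (((s * v) ^ k)⁻¹ * x * (s * v) ^ k) s := by
    rcases hpow k with h | h <;> rw [h]
    · exact hx
    · exact hx.inv_left
  have hvx' : Commute v x := by
    generalize (s * v) ^ k = g at hk hcs
    rw [← hk]
    calc g * s * g⁻¹ * x = g * (s * (g⁻¹ * x * g)) * g⁻¹ := by group
      _ = x * (g * s * g⁻¹) := by rw [← hcs.eq]; group
  have hxx : x * x = 1 := by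
    rw [hvx'.eq, mul_assoc, hvv, mul_one] at hvx
    nth_rw 1 [hvx]
    exact inv_mul_cancel x
  by_contra hx1
  exact hv (hH.mem_of_commute (hH.mem_of_commute hs hss hs1 hx) hxx hx1 hvx')

theorem exists_conj_eq (hH : ControlsInvolutions H) (hne : H ≠ ⊤) {s t : G} (hs : s ∈ H)
    (hss : s * s = 1) (hs1 : s ≠ 1) (ht : t ∈ H) (htt : t * t = 1) (ht1 : t ≠ 1) :
    ∃ y ∈ H, y * s * y⁻¹ = t := by
  obtain ⟨g, hg⟩ : ∃ g, g ∉ H := by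
    by_contra! h
    exact hne ((eq_top_iff' H).2 h)
  have hv : g * s * g⁻¹ ∉ H := fun h => hg (hH s hs hss hs1 g h)
  have hvv : g * s * g⁻¹ * (g * s * g⁻¹) = 1 := by
    calc g * s * g⁻¹ * (g * s * g⁻¹) = g * (s * s) * g⁻¹ := by group
      _ = 1 := by rw [hss]; group
  obtain ⟨k, hk⟩ := hH.exists_pow_conj_eq hs hss hs1 hv hvv
  obtain ⟨l, hl⟩ := hH.exists_pow_conj_eq ht htt ht1 hv hvv
  generalize (s * (g * s * g⁻¹)) ^ k = y at hk
  generalize (t * (g * s * g⁻¹)) ^ l = z at hl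
  have h : z⁻¹ * y * s * (z⁻¹ * y)⁻¹ = t := by
    calc z⁻¹ * y * s * (z⁻¹ * y)⁻¹ = z⁻¹ * (y * s * y⁻¹) * z := by group
      _ = t := by rw [hk, ← hl]; group
  exact ⟨z⁻¹ * y, hH s hs hss hs1 _ (h ▸ ht), h⟩

theorem eq_of_commute_inv_mul (hH : ControlsInvolutions H) {s v w : G} (hs : s ∈ H)
    (hss : s * s = 1) (hs1 : s ≠ 1) (hv : v ∉ H) (hvv : v * v = 1) (hww : w * w = 1)
    (h : Commute (v⁻¹ * w) s) : v = w := by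
  have hvi : v⁻¹ = v := inv_eq_of_mul_eq_one_left hvv
  have hwi : w⁻¹ = w := inv_eq_of_mul_eq_one_left hww
  refine inv_mul_eq_one.1 (hH.eq_one_of_commute_of_inv hs hss hs1 hv hvv h ?_)
  rw [mul_inv_rev, inv_inv, mul_inv_cancel_left, hwi]

theorem exists_commute_iff (hH : ControlsInvolutions H) {s : G} (hs : s ∈ H) (hss : s * s = 1)
    (hs1 : s ≠ 1) {g : G} (hg : g ∉ H) :
    ∃ y₀, ∀ y, Commute (g⁻¹ * (y * s * y⁻¹)) s ↔ Commute (y₀⁻¹ * y) s := by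
  have hC (x : G) : x ∈ centralizer {s} ↔ Commute x s := by
    rw [mem_centralizer_singleton_iff]
    exact ⟨fun h => h, fun h => h⟩
  have hmk (x y : G) : (x : G ⧸ centralizer {s}) = y ↔ Commute (x⁻¹ * y) s := by
    rw [QuotientGroup.eq, hC]
  have hvv (y : G) : y * s * y⁻¹ * (y * s * y⁻¹) = 1 := by
    calc y * s * y⁻¹ * (y * s * y⁻¹) = y * (s * s) * y⁻¹ := by group
      _ = 1 := by rw [hss]; group
  have hvH (y : G) (hy : y ∉ H) : y * s * y⁻¹ ∉ H := fun h => hy (hH s hs hss hs1 y h)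
  have hout (x : G) (hx : x ∉ H) : (x : G ⧸ centralizer {s}).out ∉ H := fun h => by
    have h1 := hH.mem_of_commute hs hss hs1 ((hmk _ x).1 (Quotient.out_eq' _))
    exact hx ((mul_mem_cancel_left (H.inv_mem h)).1 h1)
  have hcomm {y z : G} (h : y * s * y⁻¹ = z * s * z⁻¹) : Commute (y⁻¹ * z) s := by
    calc y⁻¹ * z * s = y⁻¹ * (z * s * z⁻¹) * z := by group
      _ = s * (y⁻¹ * z) := by rw [← h]; group
  let Ψ : {q : G ⧸ centralizer {s} // q.out ∉ H} → {q : G ⧸ centralizer {s} // q.out ∉ H} :=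
    fun q => ⟨(q.1.out * s * q.1.out⁻¹ : G), hout _ (hvH _ q.2)⟩
  have hinj : Function.Injective Ψ := by
    intro p q h
    have h1 := (hmk _ _).1 (congrArg Subtype.val h)
    have h2 := hH.eq_of_commute_inv_mul hs hss hs1 (hvH _ p.2) (hvv _) (hvv _) h1
    have h3 := (hmk _ _).2 (hcomm h2)
    rw [QuotientGroup.out_eq', QuotientGroup.out_eq'] at h3
    exact Subtype.ext h3
  obtain ⟨q, hq⟩ := Finite.surjective_of_injective hinj ⟨(g : G ⧸ centralizer {s}), hout g hg⟩
  have hq' := (hmk _ _).1 (congrArg Subtype.val hq)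
  refine ⟨q.1.out, fun y => ⟨fun h => hcomm ?_, fun h => ?_⟩⟩
  · refine hH.eq_of_commute_inv_mul hs hss hs1 (hvH _ q.2) (hvv _) (hvv _) ?_
    have := hq'.mul_left h
    rwa [mul_assoc, mul_inv_cancel_left] at this
  · have h1 : y * s * y⁻¹ = q.1.out * s * q.1.out⁻¹ := by
      calc y * s * y⁻¹ = q.1.out * ((q.1.out⁻¹ * y) * s) * y⁻¹ := by group
        _ = _ := by rw [h.eq]; group
    rw [h1]
    have := hq'.inv_left
    rwa [mul_inv_rev, inv_inv] at this

theorem card_lt_index (hH : ControlsInvolutions H) (hne : H ≠ ⊤) {P : Subgroup G}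
    (hP : IsPGroup 2 P) (hPH : P ≤ H) : Nat.card P < H.index := by
  obtain ⟨g, hg⟩ : ∃ g, g ∉ H := by
    by_contra! h
    exact hne ((eq_top_iff' H).2 h)
  have hone (u : G) (hu : u ∈ P) (hgu : g⁻¹ * u * g ∈ H) : u = 1 := by
    by_contra hu1
    obtain ⟨k, hk⟩ := IsPGroup.iff_orderOf.1 hP ⟨u, hu⟩
    rw [Subgroup.orderOf_mk] at hk
    rcases k with - | k
    · exact hu1 (orderOf_eq_one_iff.1 hk)
    · refine hg (inv_mem_iff.1 (hH (u ^ 2 ^ k) (hPH (P.pow_mem hu _)) ?_ ?_ g⁻¹ ?_))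
      · rw [← pow_add, ← mul_two, ← pow_succ, ← hk, pow_orderOf_eq_one]
      · refine fun h => absurd (orderOf_le_of_pow_eq_one (by positivity) h) ?_
        rw [hk, pow_succ]
        have : 0 < 2 ^ k := by positivity
        omega
      · rw [← conj_pow, inv_inv]
        exact H.pow_mem hgu _
  let f : Option P → G ⧸ H := fun p => p.elim ((1 : G) : G ⧸ H) fun p => ((p * g : G) : G ⧸ H)
  have hne1 (p : P) : ((1 : G) : G ⧸ H) ≠ ((p * g : G) : G ⧸ H) := fun h => by
    rw [QuotientGroup.eq, inv_one, one_mul] at h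
    exact hg ((H.mul_mem_cancel_left (hPH p.2)).1 h)
  have hf : Function.Injective f := by
    rintro (- | p) (- | q) h
    · rfl
    · exact absurd h (hne1 q)
    · exact absurd h.symm (hne1 p)
    · have h1 : ((p * g : G) : G ⧸ H) = ((q * g : G) : G ⧸ H) := h
      rw [QuotientGroup.eq] at h1
      have h2 := hone ((p : G)⁻¹ * q) (P.mul_mem (P.inv_mem p.2) q.2) (by
        convert h1 using 1
        group)
      rw [Subtype.ext (inv_mul_eq_one.1 h2)]
  have h1 := Nat.card_le_card_of_injective f hf
  rw [Finite.card_option] at h1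
  exact h1

end ControlsInvolutions

theorem controlsInvolutions_of_not_two_dvd_card
    (hH : ∀ x : G, x ∉ H → ¬ 2 ∣ Nat.card ↥(H ⊓ H.map (MulAut.conj x).toMonoidHom)) :
    ControlsInvolutions H := by
  intro s hs hss hs1 g hg
  by_contra hgH
  refine hH g hgH ?_
  have h2 : orderOf (g * s * g⁻¹) = 2 := by
    refine orderOf_eq_prime ?_ (mt conj_eq_one_iff.1 hs1)
    rw [conj_pow, pow_two, hss, mul_one, mul_inv_cancel]
  rw [← h2]
  exact Subgroup.orderOf_dvd_natCard _ ⟨hg, s, hs, rfl⟩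

theorem exists_generators_of_mulEquiv_dihedralGroup {P : Subgroup G} {j : ℕ} (hj : j ≠ 0)
    (e : P ≃* DihedralGroup (2 ^ j)) :
    ∃ x ∈ P, ∃ a ∈ P, orderOf x = 2 ^ j ∧ a * a = 1 ∧ a ∉ zpowers x ∧ a * x * a = x⁻¹ ∧
      ∀ p ∈ P, Commute p (x ^ 2 ^ (j - 1)) := by
  refine ⟨e.symm (DihedralGroup.r 1), SetLike.coe_mem _, e.symm (DihedralGroup.sr 0),
    SetLike.coe_mem _, ?_, ?_, fun h => ?_, ?_, fun p hp => ?_⟩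
  · rw [Subgroup.orderOf_coe, MulEquiv.orderOf_eq, DihedralGroup.orderOf_r_one]
  · rw [← Subgroup.coe_mul, ← map_mul, DihedralGroup.sr_mul_self, map_one, Subgroup.coe_one]
  · obtain ⟨i, hi⟩ := mem_zpowers_iff.1 h
    rw [← Subgroup.coe_zpow, ← map_zpow] at hi
    have := e.symm.injective (Subtype.ext hi)
    simp at this
  · rw [← Subgroup.coe_mul, ← Subgroup.coe_mul, ← Subgroup.coe_inv, ← map_mul, ← map_mul,
      ← map_inv]
    simp
  · obtain ⟨y, hy⟩ := e.symm.surjective ⟨p, hp⟩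
    have hp' : p = e.symm y := by rw [hy]
    have h0 : ((2 ^ (j - 1) : ℕ) : ZMod (2 ^ j)) + (2 ^ (j - 1) : ℕ) = 0 := by
      rw [← Nat.cast_add, ← mul_two, ← pow_succ, Nat.sub_add_cancel (by omega), ZMod.natCast_self]
    rw [hp', ← Subgroup.coe_pow, ← map_pow, DihedralGroup.r_one_pow]
    refine congrArg Subtype.val (?_ : e.symm y * _ = _ * e.symm y)
    rw [← map_mul, ← map_mul]
    congr 1
    rcases y with i | i
    · rw [DihedralGroup.r_mul_r, DihedralGroup.r_mul_r, add_comm]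
    · rw [DihedralGroup.sr_mul_r, DihedralGroup.r_mul_sr, sub_eq_add_neg,
        eq_neg_of_add_eq_zero_left h0, neg_neg, ← eq_neg_of_add_eq_zero_left h0]

end StronglyEmbedded

/-- a finite group whose Sylow `2`-subgroups are dihedral of order `2 ^ n` with
`n ≥ 3` has no strongly `2`-embedded subgroup. -/
theorem statement_15 (G : Type) [Group G] [Finite G]
    (hD : ∀ P : Sylow 2 G, ∃ n : ℕ, 3 ≤ n ∧
      Nonempty (↥(P : Subgroup G) ≃* DihedralGroup (2 ^ (n - 1)))) :
    ∀ S : Subgroup G, ¬ StronglyPEmbedded 2 S := by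
  rintro S ⟨hne, hcard, hS⟩
  have hH := controlsInvolutions_of_not_two_dvd_card hS
  obtain ⟨t, ht⟩ := exists_prime_orderOf_dvd_card' 2 hcard
  rw [← Subgroup.orderOf_coe] at ht
  have htP : IsPGroup 2 (Subgroup.zpowers (t : G)) :=
    IsPGroup.of_card (n := 1) (by rw [Nat.card_zpowers, ht, pow_one])
  obtain ⟨P, hP⟩ := htP.exists_le_sylow
  obtain ⟨n, hn, ⟨e⟩⟩ := hD P
  obtain ⟨j, rfl⟩ : ∃ j, n = j + 1 := ⟨n - 1, by omega⟩
  rw [Nat.add_sub_cancel] at e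
  obtain ⟨x, -, a, haP, hx, ha, hax, haxa, hcomm⟩ :=
    exists_generators_of_mulEquiv_dihedralGroup (by omega) e
  obtain ⟨s, hs⟩ : ∃ s, s = x ^ 2 ^ (j - 1) := ⟨_, rfl⟩
  rw [← hs] at hcomm
  have hj2 : 2 ^ j = 2 ^ (j - 1) * 2 := by
    rw [← pow_succ, Nat.sub_add_cancel (by omega)]
  have hss : s * s = 1 := by
    rw [hs, ← pow_add, ← mul_two, ← hj2, ← hx, pow_orderOf_eq_one]
  have hs1 : s ≠ 1 := fun h => by
    have h1 := orderOf_le_of_pow_eq_one (by positivity) (hs ▸ h)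
    have : 0 < 2 ^ (j - 1) := by positivity
    omega
  have htt : (t : G) * t = 1 := by rw [← pow_two, ← ht, pow_orderOf_eq_one]
  have ht1 : (t : G) ≠ 1 := fun h => by simp [h] at ht
  have hsS : s ∈ S := hH.mem_of_commute t.2 htt ht1
    (hcomm t (hP (Subgroup.mem_zpowers _))).symm
  have hC (g : G) (hg : Commute g s) : g ∈ S := hH.mem_of_commute hsS hss hs1 hg
  have hPS : (P : Subgroup G) ≤ S := fun p hp => hC p (hcomm p hp)
  have hPC : (P : Subgroup G) ≤ Subgroup.centralizer {s} := fun p hp =>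
    Subgroup.mem_centralizer_singleton_iff.2 (hcomm p hp)
  have hcardP : Nat.card P = 2 * 2 ^ j := by rw [Nat.card_congr e.toEquiv, DihedralGroup.nat_card]
  have hcardC : Nat.card (Subgroup.centralizer {s}) =
      2 * (2 ^ j * (P : Subgroup G).relIndex (Subgroup.centralizer {s})) := by
    rw [← mul_assoc, ← hcardP, ← Subgroup.relIndex_bot_left, ← Subgroup.relIndex_bot_left]
    exact (Subgroup.relIndex_mul_relIndex _ _ _ bot_le hPC).symm
  have hq : Odd ((P : Subgroup G).relIndex (Subgroup.centralizer {s})) := by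
    rw [← Nat.not_even_iff_odd, even_iff_two_dvd]
    exact fun h => P.not_dvd_index (h.trans (Subgroup.relIndex_dvd_index_of_le hPC))
  obtain ⟨K, L, hKL⟩ := exists_dihedralData (by omega) hx hs ha hax haxa hcardC hq
  have hidx : 9 ≤ S.index := by
    have h1 := hH.card_lt_index hne P.2 hPS
    have h2 : 2 ^ 2 ≤ 2 ^ j := Nat.pow_le_pow_right (by norm_num) (by omega)
    have h3 : Nat.card P < S.index := h1
    omega
  have := Fintype.ofFinite G
  have := Fintype.ofFinite S
  obtain ⟨d, e, D, E, hd, hed, hED, hprod, hpos, heq⟩ := hKL.exists_degrees hsS (hPS haP)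
    (fun k hk => hC k ((hKL.commute_iff k).2 (Or.inl hk))) hC (hH s hsS hss hs1)
    (fun g hg => hH.exists_commute_iff hsS hss hs1 hg)
    (fun t ht htt ht1 => hH.exists_conj_eq hne hsS hss hs1 ht htt ht1)
  exact no_strongly_embedded_degrees hidx hd hed hED hprod hpos heq
end
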